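/- Suppose f is good with right derivative satisfying f′(x) ≤ 1/(2(x+1)), and suppose the generic structure M_f is elementarily equivalent to an ultraproduct 𝓜 = ∏_U F_i of finite L-structures with |F_i| → ∞. Let ā be a k-tuple in M_f and b ∈ M_f, and let Φ_ā(x̄) and Φ_{āb}(x̄, y) be L-formulas isolating the types of ā and of āb over ∅ in M_f (these exist by ω-categoricity). Then for every ū ∈ 𝓜^k with 𝓜 ⊨ Φ_ā(ū), the coarse pseudofinite dimension satisfies Δ(Φ_{āb}(ū, y)) = d(b/ā), where d(b/ā) = d^{M_f}(ā ∪ {b}) − d^{M_f}(ā). -/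

import Mathlib

open FirstOrder Set

namespace MeasureAmalgamation

variable (L : FirstOrder.Language)

/-- The predimension `δ(A) = |A| − Σ_i |R_i[A]|` of a (finite) subset `A` of an
`L`-structure: the number of points minus the number of relation instances inside `A`. -/
noncomputable def delta {N : Type*} [L.Structure N] (A : Set N) : ℤ :=
  (A.ncard : ℤ) -
    (Set.ncard {p : Σ n, L.Relations n × (Fin n → N) |
      (∀ i, p.2.2 i ∈ A) ∧ Language.Structure.RelMap p.2.1 p.2.2} : ℤ)

/-- `A ≤ B` (`A` is self-sufficient in `B`): `A ⊆ B` and `δ(A) < δ(B′)` whenever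
`A ⊊ B′ ⊆ B` with `B′` finite. -/
def SelfSuffIn {N : Type*} [L.Structure N] (A B : Set N) : Prop :=
  A ⊆ B ∧ ∀ B' : Set N, A ⊂ B' → B' ⊆ B → B'.Finite → delta L A < delta L B'

/-- `A ≤ M` for the (possibly infinite) ambient structure:
`A ∩ X ≤ X` for every finite `X ⊆ M`. -/
def SelfSuffM {N : Type*} [L.Structure N] (A : Set N) : Prop :=
  ∀ X : Set N, X.Finite → SelfSuffIn L (A ∩ X) X

/-- The closure `cl_B(X)`: the smallest self-sufficient subset of `B` containing `X`. -/
def clIn {N : Type*} [L.Structure N] (X B : Set N) : Set N :=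
  ⋂₀ {A : Set N | X ⊆ A ∧ SelfSuffIn L A B}

/-- The dimension `d^B(X) = δ(cl_B(X))`. -/
noncomputable def dIn {N : Type*} [L.Structure N] (X B : Set N) : ℤ :=
  delta L (clIn L X B)

/-- The closure `cl_M(X)` in the ambient structure. -/
def clM {N : Type*} [L.Structure N] (X : Set N) : Set N :=
  ⋂₀ {A : Set N | X ⊆ A ∧ SelfSuffM L A}

/-- The dimension `d(X) = δ(cl_M(X))` in the ambient structure. -/
noncomputable def dM {N : Type*} [L.Structure N] (X : Set N) : ℤ :=
  delta L (clM L X)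

/-- Membership in the class `K_f`: every (finite) subset `X` satisfies
`δ(X) ≥ f(|X|)`. -/
def InKf (f : ℝ → ℝ) (B : Type*) [L.Structure B] : Prop :=
  ∀ X : Set B, X.Finite → f X.ncard ≤ (delta L X : ℝ)

/-- `f` is a good function (continuous, increasing, unbounded) certified by the standard
conditions guaranteeing the free amalgamation property for `(K_f, ≤)`: `f` has a
non-increasing right derivative `g` with `g(x) ≤ 1/(x+1)`. -/
structure IsGoodFun (f g : ℝ → ℝ) : Prop where
  cont : ContinuousOn f (Set.Ici 0)
  mono : StrictMonoOn f (Set.Ici 0)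
  unbounded : Filter.Tendsto f Filter.atTop Filter.atTop
  rightDeriv : ∀ x ∈ Set.Ici (0 : ℝ), HasDerivWithinAt f (g x) (Set.Ici x) x
  anti : AntitoneOn g (Set.Ici 0)
  bound : ∀ x ∈ Set.Ici (0 : ℝ), g x ≤ 1 / (x + 1)

/-- Any subset of a structure in a relational language is (the carrier of) a
substructure. -/
def relSub {N : Type*} [L.Structure N] [L.IsRelational] (A : Set N) :
    L.Substructure N where
  carrier := A
  fun_mem := fun {_} f => isEmptyElim f

/-- `N` is the generic structure `M_f` of the amalgamation class `(K_f, ≤)`: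
(1) `N` is the union of a chain of finite self-sufficient substructures, all in `K_f`;
(2) (`≤`-extension property) if `A ≤ N` is finite and `A ≤ B ∈ K_f`, then there is a
`≤`-embedding `β : B → N` fixing `A` pointwise. -/
def IsGeneric {N : Type*} [L.Structure N] [L.IsRelational] (f : ℝ → ℝ) : Prop :=
  (∃ c : ℕ → Set N, Monotone c ∧ (∀ k, (c k).Finite) ∧ (∀ k, SelfSuffM L (c k)) ∧
    (∀ (k : ℕ) (X : Set N), X ⊆ c k → f X.ncard ≤ (delta L X : ℝ)) ∧
    (⋃ k, c k) = Set.univ) ∧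
  (∀ A : Set N, A.Finite → SelfSuffM L A →
    ∀ (B : Type) (_ : Fintype B) (_ : L.Structure B), InKf L f B →
      ∀ e : ↥(relSub L A) ↪[L] B,
        SelfSuffIn L (Set.range ⇑e) (Set.univ : Set B) →
        ∃ g : B ↪[L] N, (∀ a : ↥(relSub L A), g (e a) = ↑a) ∧
          SelfSuffM L (Set.range ⇑g))

/-- Two tuples have the same complete type over `∅`. -/
def sameType {N : Type*} [L.Structure N] {k : ℕ} (a a' : Fin k → N) : Prop :=
  ∀ φ : L.Formula (Fin k), φ.Realize a ↔ φ.Realize a'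

/-- The locus `loc(b̄/ā)`: the set of realizations in `N` of the complete type of `b̄`
over `ā`. -/
def locus {N : Type*} [L.Structure N] {k m : ℕ} (a : Fin k → N) (b : Fin m → N) :
    Set (Fin m → N) :=
  {y | sameType L (Fin.append a y) (Fin.append a b)}

/-- A subset of `M` viewed as a subset of the power `M^{Fin 1}`. -/
def toDef1 (M : Type*) (s : Set M) : Set (Fin 1 → M) := {x | x 0 ∈ s}

/-- Algebraic closure: `b ∈ acl(Z)` iff `b` belongs to some finite `Z`-definable set. -/
def inAcl {M : Type*} [L.Structure M] (Z : Set M) (b : M) : Prop :=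
  ∃ s : Set M, b ∈ s ∧ s.Finite ∧ Z.Definable L (toDef1 M s)


section Part1
/-- The set of relation instances inside `A`. -/
def relsIn {N : Type*} [L.Structure N] (A : Set N) :
    Set (Σ n, L.Relations n × (Fin n → N)) :=
  {p | (∀ i, p.2.2 i ∈ A) ∧ Language.Structure.RelMap p.2.1 p.2.2}

theorem delta_eq {N : Type*} [L.Structure N] (A : Set N) :
    delta L A = (A.ncard : ℤ) - ((relsIn L A).ncard : ℤ) := rfl

theorem relsIn_finite [Finite (Σ n, L.Relations n)] {N : Type*} [L.Structure N] {A : Set N}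
    (hA : A.Finite) : (relsIn L A).Finite := by
  have : Finite A := hA
  let F : (Σ p : (Σ n, L.Relations n), (Fin p.1 → A)) → Σ n, L.Relations n × (Fin n → N) :=
    fun q => ⟨q.1.1, q.1.2, fun i => (q.2 i : N)⟩
  refine (Set.finite_range F).subset ?_
  rintro ⟨n, R, v⟩ ⟨h1, h2⟩
  exact ⟨⟨⟨n, R⟩, fun i => ⟨v i, h1 i⟩⟩, rfl⟩

theorem relsIn_mono {N : Type*} [L.Structure N] {A B : Set N} (h : A ⊆ B) :
    relsIn L A ⊆ relsIn L B := fun _ hp => ⟨fun i => h (hp.1 i), hp.2⟩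

theorem relsIn_inter {N : Type*} [L.Structure N] (A B : Set N) :
    relsIn L (A ∩ B) = relsIn L A ∩ relsIn L B := by
  ext p
  constructor
  · intro h
    exact ⟨⟨fun i => (h.1 i).1, h.2⟩, ⟨fun i => (h.1 i).2, h.2⟩⟩
  · intro h
    exact ⟨fun i => ⟨h.1.1 i, h.2.1 i⟩, h.1.2⟩

theorem delta_submod [Finite (Σ n, L.Relations n)] {N : Type*} [L.Structure N] {A B : Set N}
    (hA : A.Finite) (hB : B.Finite) :
    delta L (A ∪ B) + delta L (A ∩ B) ≤ delta L A + delta L B := by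
  have h1 := Set.ncard_union_add_ncard_inter A B hA hB
  have h2 := Set.ncard_union_add_ncard_inter (relsIn L A) (relsIn L B)
    (relsIn_finite L hA) (relsIn_finite L hB)
  have h3 : (relsIn L A ∪ relsIn L B).ncard ≤ (relsIn L (A ∪ B)).ncard :=
    Set.ncard_le_ncard (Set.union_subset (relsIn_mono L Set.subset_union_left)
      (relsIn_mono L Set.subset_union_right)) (relsIn_finite L (hA.union hB))
  rw [← relsIn_inter] at h2
  simp only [delta_eq]
  omega

theorem delta_le_ncard {N : Type*} [L.Structure N] (A : Set N) :
    delta L A ≤ A.ncard := by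
  rw [delta_eq]; omega

theorem delta_insert_le [Finite (Σ n, L.Relations n)] {N : Type*} [L.Structure N] {A : Set N}
    (hA : A.Finite) (b : N) : delta L (insert b A) ≤ delta L A + 1 := by
  have h1 := Set.ncard_insert_le b A
  have h2 : (relsIn L A).ncard ≤ (relsIn L (insert b A)).ncard :=
    Set.ncard_le_ncard (relsIn_mono L (Set.subset_insert b A)) (relsIn_finite L (hA.insert b))
  simp only [delta_eq]; omega

/-- map on relation instances. -/
def relPush {N N' : Type*} (h : N → N') :
    (Σ n, L.Relations n × (Fin n → N)) → (Σ n, L.Relations n × (Fin n → N')) :=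
  fun p => ⟨p.1, p.2.1, h ∘ p.2.2⟩

theorem relPush_injOn {N N' : Type*} [L.Structure N] {h : N → N'} {A : Set N}
    (hi : Set.InjOn h A) : Set.InjOn (relPush L h) (relsIn L A) := by
  rintro ⟨n, R, v⟩ hv ⟨m, S, w⟩ hw heq
  simp only [relPush, Sigma.mk.injEq] at heq
  obtain ⟨rfl, heq⟩ := heq
  simp only [heq_eq_eq, Prod.mk.injEq] at heq
  obtain ⟨rfl, heq⟩ := heq
  have : v = w := by
    funext i
    exact hi (hv.1 i) (hw.1 i) (congrFun heq i)
  rw [this]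

/-- `h` is a partial isomorphism with domain `A`. -/
def PIso {N N' : Type*} [L.Structure N] [L.Structure N'] (h : N → N') (A : Set N) : Prop :=
  Set.InjOn h A ∧ ∀ (n : ℕ) (R : L.Relations n) (v : Fin n → N), (∀ i, v i ∈ A) →
    (Language.Structure.RelMap R (h ∘ v) ↔ Language.Structure.RelMap R v)

theorem delta_image_le [Finite (Σ n, L.Relations n)] {N N' : Type*} [L.Structure N]
    [L.Structure N'] {h : N → N'} {A : Set N} (hA : A.Finite)
    (hi : Set.InjOn h A) (hr : ∀ (n : ℕ) (R : L.Relations n) (v : Fin n → N), (∀ i, v i ∈ A) →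
      Language.Structure.RelMap R v → Language.Structure.RelMap R (h ∘ v)) :
    delta L (h '' A) ≤ delta L A := by
  have h1 := Set.ncard_image_of_injOn hi
  have h2 := Set.ncard_image_of_injOn (relPush_injOn L hi)
  have h3 : (relPush L h '' relsIn L A).ncard ≤ (relsIn L (h '' A)).ncard := by
    refine Set.ncard_le_ncard ?_ (relsIn_finite L (hA.image h))
    rintro _ ⟨⟨n, R, v⟩, hv, rfl⟩
    exact ⟨fun i => ⟨_, hv.1 i, rfl⟩, hr n R v hv.1 hv.2⟩
  simp only [delta_eq]; omega

theorem PIso.delta_image {N N' : Type*} [L.Structure N]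
    [L.Structure N'] {h : N → N'} {A : Set N} (hp : PIso L h A) :
    delta L (h '' A) = delta L A := by
  have h1 := Set.ncard_image_of_injOn hp.1
  have h2 := Set.ncard_image_of_injOn (relPush_injOn L hp.1)
  have h3 : (relPush L h '' relsIn L A) = (relsIn L (h '' A)) := by
    apply Set.Subset.antisymm
    · rintro _ ⟨⟨n, R, v⟩, hv, rfl⟩
      exact ⟨fun i => ⟨_, hv.1 i, rfl⟩, (hp.2 n R v hv.1).2 hv.2⟩
    · rintro ⟨n, R, w⟩ ⟨hw, hR⟩
      choose v hv using hw
      simp only at hv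
      refine ⟨⟨n, R, v⟩, ⟨fun i => (hv i).1, ?_⟩, ?_⟩
      · refine (hp.2 n R v (fun i => (hv i).1)).1 ?_
        have : h ∘ v = w := funext fun i => (hv i).2
        rw [this]; exact hR
      · have : h ∘ v = w := funext fun i => (hv i).2
        simp only [relPush, this]
  rw [h3] at h2
  simp only [delta_eq, h1, h2]

theorem PIso.mono {N N' : Type*} [L.Structure N]
    [L.Structure N'] {h : N → N'} {A B : Set N} (hp : PIso L h A) (hB : B ⊆ A) : PIso L h B :=
  ⟨hp.1.mono hB, fun n R v hv => hp.2 n R v fun i => hB (hv i)⟩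

theorem PIso.comp {N N' N'' : Type*} [L.Structure N] [L.Structure N''] 
    [L.Structure N'] {h : N → N'} {h' : N' → N''} {A : Set N} (hp : PIso L h A)
    (hp' : PIso L h' (h '' A)) : PIso L (h' ∘ h) A :=
  ⟨hp'.1.comp hp.1 (Set.mapsTo_image h A), fun n R v hv => by
    rw [Function.comp_assoc, hp'.2 n R (h ∘ v) (fun i => ⟨_, hv i, rfl⟩), hp.2 n R v hv]⟩

theorem PIso.of_embedding {N N' : Type*} [L.Structure N] [L.Structure N'] (e : N ↪[L] N')
    (A : Set N) : PIso L e A :=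
  ⟨e.injective.injOn, fun _ R v _ => e.map_rel R v⟩

/-- finite self-sufficient sets -/
def Closed {N : Type*} [L.Structure N] (A : Set N) : Prop :=
  A.Finite ∧ ∀ B : Set N, A ⊂ B → B.Finite → delta L A < delta L B

theorem Closed.rel_lt [Finite (Σ n, L.Relations n)] {N : Type*} [L.Structure N] {A X : Set N}
    (hA : Closed L A) (hX : X.Finite) (h : ¬ X ⊆ A) : delta L (X ∩ A) < delta L X := by
  have h1 := delta_submod L hX hA.1
  have h2 := hA.2 (X ∪ A) ?_ (hX.union hA.1)
  · omega
  · refine ⟨Set.subset_union_right, fun h3 => h (Set.subset_union_left.trans h3)⟩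

theorem Closed.rel_le [Finite (Σ n, L.Relations n)] {N : Type*} [L.Structure N] {A X : Set N}
    (hA : Closed L A) (hX : X.Finite) : delta L (X ∩ A) ≤ delta L X := by
  by_cases h : X ⊆ A
  · rw [Set.inter_eq_left.2 h]
  · exact (hA.rel_lt L hX h).le

theorem Closed.selfSuffM [Finite (Σ n, L.Relations n)] {N : Type*} [L.Structure N] {A : Set N}
    (hA : Closed L A) : SelfSuffM L A := by
  intro X hX
  refine ⟨Set.inter_subset_right, fun B' h1 h2 h3 => ?_⟩
  have : B' ∩ A = A ∩ X := by
    apply Set.Subset.antisymm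
    · exact fun x hx => ⟨hx.2, h2 hx.1⟩
    · exact fun x hx => ⟨h1.1 hx, hx.1⟩
  rw [← this]
  apply hA.rel_lt L h3
  intro h4
  exact h1.2 fun x hx => ⟨h4 hx, h2 hx⟩

theorem SelfSuffM.closed {N : Type*} [L.Structure N] {A : Set N}
    (hA : SelfSuffM L A) (hf : A.Finite) : Closed L A := by
  refine ⟨hf, fun B h1 h2 => ?_⟩
  have := (hA B h2).2 B
  rw [Set.inter_eq_left.2 h1.1] at this
  exact this h1 Set.Subset.rfl h2

/-- transport of relative self-sufficiency: `D ≤ B` inside `B`, image of `B` is closed. -/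
theorem closed_trans [Finite (Σ n, L.Relations n)] {N : Type*} [L.Structure N] {A B : Set N}
    (hB : Closed L B) (hAB : SelfSuffIn L A B) : Closed L A := by
  refine ⟨hB.1.subset hAB.1, fun X h1 h2 => ?_⟩
  by_cases h : X ⊆ B
  · exact hAB.2 X h1 h h2
  · have h3 := hB.rel_lt L h2 h
    rcases eq_or_ne A (X ∩ B) with h4 | h4
    · rw [h4]; exact h3
    · refine lt_trans (hAB.2 (X ∩ B) ?_ Set.inter_subset_right (h2.inter_of_left B)) h3
      exact (Set.subset_inter h1.1 hAB.1).ssubset_of_ne h4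

theorem SelfSuffIn.image [Finite (Σ n, L.Relations n)] {N N' : Type*} [L.Structure N]
    [L.Structure N'] {h : N → N'} {A B : Set N}
    (hp : PIso L h B) (hAB : SelfSuffIn L A B) : SelfSuffIn L (h '' A) (h '' B) := by
  refine ⟨Set.image_mono hAB.1, fun X h1 h2 h3 => ?_⟩
  obtain ⟨Y, hY, rfl⟩ := Set.subset_image_iff.1 h2
  rw [(hp.mono L hAB.1).delta_image, (hp.mono L hY).delta_image]
  refine hAB.2 Y ?_ hY ?_
  · refine ⟨fun x hx => ?_, fun h4 => h1.2 (Set.image_mono h4)⟩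
    obtain ⟨y, hy, hyx⟩ := h1.1 ⟨x, hx, rfl⟩
    rwa [← hp.1 (hY hy) (hAB.1 hx) hyx]
  · exact Set.Finite.of_finite_image h3 (hp.1.mono hY)
end Part1

section Part2
theorem good_slope {f g : ℝ → ℝ} (hf : IsGoodFun f g)
    (hg : ∀ x ∈ Set.Ici (0 : ℝ), g x ≤ 1 / (2 * (x + 1))) {x y : ℝ} (hx : 0 ≤ x) (hxy : x ≤ y) :
    f y ≤ f x + (y - x) / (2 * (x + 1)) := by
  have key := image_le_of_deriv_right_le_deriv_boundary (f := f) (f' := g) (a := x) (b := y)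
    (B := fun t => f x + (t - x) / (2 * (x + 1))) (B' := fun _ => 1 / (2 * (x + 1)))
    (hf.cont.mono fun t ht => hx.trans ht.1)
    (fun t ht => hf.rightDeriv t (hx.trans ht.1)) (by simp) (by fun_prop)
    (fun t _ => by
      have h1 : HasDerivAt (fun t => f x + (t - x) / (2 * (x + 1))) (1 / (2 * (x + 1))) t :=
        (((hasDerivAt_id t).sub_const x).div_const _).const_add _
      exact h1.hasDerivWithinAt)
    (fun t ht => by
      refine (hg t (hx.trans ht.1)).trans ?_
      have := ht.1
      gcongr)
  exact key ⟨hxy, le_rfl⟩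

theorem good_slope_nat {f g : ℝ → ℝ} (hf : IsGoodFun f g)
    (hg : ∀ x ∈ Set.Ici (0 : ℝ), g x ≤ 1 / (2 * (x + 1))) {x y : ℕ} {q : ℕ} (hxy : x ≤ y)
    (h : y ≤ x + 2 * q * (x + 1)) :
    f y ≤ f x + q := by
  have h1 := good_slope hf hg (x := x) (y := y) (by positivity) (by exact_mod_cast hxy)
  have h2 : ((y : ℝ) - x) / (2 * (x + 1)) ≤ q := by
    rw [div_le_iff₀ (by positivity)]
    have : (y : ℝ) ≤ x + 2 * q * (x + 1) := by exact_mod_cast h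
    linarith
  linarith

section
variable [Finite (Σ n, L.Relations n)] {N : Type*} [L.Structure N]

theorem exists_closure {f : ℝ → ℝ} (hmono : StrictMonoOn f (Set.Ici 0))
    (hunb : Filter.Tendsto f Filter.atTop Filter.atTop)
    (hlow : ∀ X : Set N, X.Finite → f X.ncard ≤ (delta L X : ℝ)) (X : Set N) (hX : X.Finite) :
    Closed L (clM L X) ∧ X ⊆ clM L X ∧
      ∀ B : Set N, B.Finite → X ⊆ B → delta L (clM L X) ≤ delta L B := by
  obtain ⟨m, ⟨B0, hB0, hXB0, hm0⟩, hmin⟩ := Int.exists_least_of_bdd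
    (P := fun z => ∃ B : Set N, B.Finite ∧ X ⊆ B ∧ delta L B = z)
    ⟨⌊f 0⌋, by
      rintro z ⟨B, hB, -, rfl⟩
      have h1 := hlow B hB
      have h2 : f 0 ≤ f B.ncard := hmono.monotoneOn (by simp) (by simp) (by positivity)
      have : (⌊f 0⌋ : ℝ) ≤ delta L B := (Int.floor_le _).trans (h2.trans h1)
      exact_mod_cast this⟩ ⟨_, X, hX, Set.Subset.rfl, rfl⟩
  obtain ⟨T, hT⟩ := (hunb.eventually_gt_atTop (m : ℝ)).exists_forall_of_atTop
  obtain ⟨n, ⟨B, hB, hXB, hm, hn⟩, hmax⟩ := Int.exists_greatest_of_bdd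
    (P := fun z => ∃ B : Set N, B.Finite ∧ X ⊆ B ∧ delta L B = m ∧ (B.ncard : ℤ) = z)
    ⟨⌈T⌉, by
      rintro z ⟨B, hB, -, h1, rfl⟩
      by_contra! hlt
      have h2 : T ≤ (B.ncard : ℝ) := (Int.le_ceil T).trans (by exact_mod_cast hlt.le)
      have h3 := hT _ h2
      have h4 := hlow B hB
      rw [h1] at h4
      linarith⟩ ⟨_, B0, hB0, hXB0, hm0, rfl⟩
  have hcl : Closed L B := by
    refine ⟨hB, fun B' h1 h2 => ?_⟩
    have h3 := hmin _ ⟨B', h2, hXB.trans h1.1, rfl⟩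
    rcases h3.lt_or_eq with h4 | h4
    · rw [hm]; exact h4
    · have h5 := hmax _ ⟨B', h2, hXB.trans h1.1, h4.symm, rfl⟩
      have h6 := Set.ncard_lt_ncard h1 h2
      omega
  have heq : clM L X = B := by
    apply Set.Subset.antisymm
    · exact Set.sInter_subset_of_mem ⟨hXB, hcl.selfSuffM⟩
    · apply Set.subset_sInter
      rintro A ⟨hXA, hA⟩
      by_contra hne
      have h1 := (hA B hB).2 B ⟨Set.inter_subset_right, fun h => hne fun x hx => (h hx).1⟩
        Set.Subset.rfl hB
      have h2 := hmin _ ⟨A ∩ B, hB.inter_of_right A, Set.subset_inter hXA hXB, rfl⟩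
      omega
  rw [heq]
  exact ⟨hcl, hXB, fun B' h1 h2 => by rw [hm]; exact hmin _ ⟨B', h1, h2, rfl⟩⟩

theorem exists_card_bound {f : ℝ → ℝ} (hmono : StrictMonoOn f (Set.Ici 0))
    (hunb : Filter.Tendsto f Filter.atTop Filter.atTop)
    (hlow : ∀ X : Set N, X.Finite → f X.ncard ≤ (delta L X : ℝ)) (n : ℕ) :
    ∃ K : ℕ, ∀ X : Set N, X.Finite → X.ncard ≤ n → (clM L X).ncard ≤ K := by
  obtain ⟨T, hT⟩ := (hunb.eventually_gt_atTop (n : ℝ)).exists_forall_of_atTop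
  refine ⟨⌈T⌉₊, fun X hX hn => ?_⟩
  by_contra! hlt
  obtain ⟨h1, h2, h3⟩ := exists_closure L hmono hunb hlow X hX
  have h4 := hT _ ((Nat.le_ceil T).trans (Nat.cast_le.2 hlt.le))
  have h5 := hlow _ h1.1
  have h6 := h3 X hX Set.Subset.rfl
  have h7 := delta_le_ncard L X
  have h8 : (delta L (clM L X) : ℝ) ≤ n := by
    have : delta L (clM L X) ≤ n := by omega
    exact_mod_cast this
  linarith

end

section generic
variable [L.IsRelational]

theorem generic_low {N : Type*} [L.Structure N] {f : ℝ → ℝ} (hgen : IsGeneric L (N := N) f) :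
    ∀ X : Set N, X.Finite → ∃ D : Set N, D.Finite ∧ SelfSuffM L D ∧ X ⊆ D ∧
      ∀ Y : Set N, Y ⊆ D → f Y.ncard ≤ (delta L Y : ℝ) := by
  obtain ⟨⟨c, hc, hfin, hss, hlow, hun⟩, -⟩ := hgen
  intro X hX
  have : ∃ k, X ⊆ c k := by
    have h1 : X ⊆ ⋃ k, c k := by rw [hun]; exact Set.subset_univ _
    induction X, hX using Set.Finite.induction_on with
    | empty => exact ⟨0, Set.empty_subset _⟩
    | insert _ _ ih =>
      obtain ⟨k, hk⟩ := ih ((Set.subset_insert _ _).trans h1)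
      obtain ⟨l, hl⟩ := Set.mem_iUnion.1 (h1 (Set.mem_insert _ _))
      exact ⟨max k l, Set.insert_subset (hc (le_max_right k l) hl)
        (hk.trans (hc (le_max_left k l)))⟩
  obtain ⟨k, hk⟩ := this
  exact ⟨c k, hfin k, hss k, hk, hlow k⟩
  
theorem generic_low' {N : Type*} [L.Structure N] {f : ℝ → ℝ} (hgen : IsGeneric L (N := N) f) :
    ∀ X : Set N, X.Finite → f X.ncard ≤ (delta L X : ℝ) := by
  intro X hX
  obtain ⟨D, _, _, h, h'⟩ := generic_low L hgen X hX
  exact h' X h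

variable [Finite (Σ n, L.Relations n)] 

/-- Extension property in set form: `B ⊆ M` finite in some structure, `e : N → M` partial
isomorphism on a closed set `A`, image self-sufficient in `B`. -/
theorem generic_ext {N M : Type} [Nonempty N] [L.Structure N] [L.Structure M] {f : ℝ → ℝ}
    (hgen : IsGeneric L (N := N) f) {A : Set N} (hA : Closed L A) (e : N → M) (he : PIso L e A)
    {B : Set M} (hB : B.Finite) (hAB : SelfSuffIn L (e '' A) B)
    (hK : ∀ X : Set M, X ⊆ B → f X.ncard ≤ (delta L X : ℝ)) :
    ∃ g : M → N, PIso L g B ∧ Closed L (g '' B) ∧ ∀ x ∈ A, g (e x) = x := by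
  classical
  have hpi : PIso L (Subtype.val : ↥(relSub L B) → M) Set.univ :=
    PIso.of_embedding L (relSub L B).subtype _
  have hdelta : ∀ X : Set ↥(relSub L B), delta L (Subtype.val '' X) = delta L X := fun X =>
    (hpi.mono L (Set.subset_univ X)).delta_image
  have hfB : Fintype ↥(relSub L B) := hB.fintype
  have hmem : ∀ x : ↥(relSub L A), e x ∈ relSub L B := fun x => hAB.1 ⟨x, x.2, rfl⟩
  let E : ↥(relSub L A) ↪[L] ↥(relSub L B) :=
    { toFun := fun x => ⟨e x, hmem x⟩
      inj' := fun x y h => Subtype.ext (he.1 x.2 y.2 (congrArg Subtype.val h))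
      map_fun' := fun {_} F => isEmptyElim F
      map_rel' := fun {n} R v => by
        have := he.2 n R (fun i => (v i : N)) (fun i => (v i).2)
        exact this }
  have hE : ∀ x, ((E x : ↥(relSub L B)) : M) = e x := fun x => rfl
  have hk1 : InKf L f ↥(relSub L B) := by
    intro X hX
    have := hK (Subtype.val '' X) (by rintro _ ⟨x, -, rfl⟩; exact x.2)
    rw [hdelta, Set.ncard_image_of_injective _ Subtype.val_injective] at this
    exact this
  have hk2 : SelfSuffIn L (Set.range ⇑E) (Set.univ : Set ↥(relSub L B)) := by
    refine ⟨Set.subset_univ _, fun X h1 h2 h3 => ?_⟩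
    have himg : Subtype.val '' Set.range ⇑E = e '' A := by
      ext x; constructor
      · rintro ⟨_, ⟨y, rfl⟩, rfl⟩; exact ⟨y, y.2, rfl⟩
      · rintro ⟨y, hy, rfl⟩; exact ⟨_, ⟨⟨y, hy⟩, rfl⟩, rfl⟩
    rw [← hdelta, ← hdelta, himg]
    refine hAB.2 _ ?_ (by rintro _ ⟨x, -, rfl⟩; exact x.2) (h3.image _)
    rw [← himg]
    exact ⟨Set.image_mono h1.1, fun h => h1.2 ((Set.image_subset_image_iff Subtype.val_injective).1 h)⟩
  obtain ⟨G, hG1, hG2⟩ := hgen.2 A hA.1 hA.selfSuffM ↥(relSub L B) hfB inferInstance hk1 E hk2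
  · let g : M → N := fun x => if h : x ∈ B then G ⟨x, h⟩ else Classical.arbitrary N
    have hg : ∀ x : ↥(relSub L B), g x = G x := fun x => dif_pos x.2
    refine ⟨g, ⟨?_, ?_⟩, ?_, ?_⟩
    · intro x hx y hy hxy
      have h1 := hg ⟨x, hx⟩
      have h2 := hg ⟨y, hy⟩
      simp only at h1 h2
      rw [h1, h2] at hxy
      exact congrArg Subtype.val (G.injective hxy)
    · intro n R v hv
      let w : Fin n → ↥(relSub L B) := fun i => ⟨v i, hv i⟩
      have h1 : g ∘ v = G ∘ w := funext fun i => hg (w i)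
      rw [h1]
      exact G.map_rel R w
    · have h1 : g '' B = Set.range G := by
        ext x; constructor
        · rintro ⟨y, hy, rfl⟩; exact ⟨⟨y, hy⟩, (hg ⟨y, hy⟩).symm⟩
        · rintro ⟨y, rfl⟩; exact ⟨y, y.2, hg y⟩
      rw [h1]
      exact hG2.closed L (Set.finite_range G)
    · intro x hx
      have h1 := hg (E ⟨x, hx⟩)
      rw [hE] at h1
      simp only at h1
      rw [h1, hG1]
end generic
end Part2

section Part3
theorem Closed.selfSuffIn {N : Type*} [L.Structure N] {A B : Set N} (hA : Closed L A)
    (h : A ⊆ B) : SelfSuffIn L A B := ⟨h, fun X h1 _ h3 => hA.2 X h1 h3⟩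

theorem PIso.inv {N N' : Type*} [Nonempty N] [L.Structure N] [L.Structure N'] {h : N → N'}
    {A : Set N} (hp : PIso L h A) : PIso L (Function.invFunOn h A) (h '' A) := by
  have hl := hp.1.leftInvOn_invFunOn
  refine ⟨?_, ?_⟩
  · rintro _ ⟨x, hx, rfl⟩ _ ⟨y, hy, rfl⟩ hxy
    rw [hl hx, hl hy] at hxy
    rw [hxy]
  · intro n R w hw
    choose v hv using hw
    have h1 : w = h ∘ v := funext fun i => (hv i).2.symm
    have h2 : Function.invFunOn h A ∘ w = v := by
      rw [h1]; exact funext fun i => hl (hv i).1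
    rw [h2, h1]
    exact (hp.2 n R v fun i => (hv i).1).symm

section
variable [L.IsRelational] [Finite (Σ n, L.Relations n)]

theorem back_and_forth {N : Type} [Nonempty N] [L.Structure N] {f : ℝ → ℝ}
    (hgen : IsGeneric L (N := N) f) {α : Type} {n : ℕ} (φ : L.BoundedFormula α n) :
    ∀ (h : N → N) (A : Set N), Closed L A → PIso L h A → Closed L (h '' A) →
      ∀ (v : α → N) (xs : Fin n → N), (∀ i, v i ∈ A) → (∀ i, xs i ∈ A) →
        (φ.Realize v xs ↔ φ.Realize (h ∘ v) (h ∘ xs)) := by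
  have hterm : ∀ {n : ℕ} (t : L.Term (α ⊕ Fin n)) (h : N → N) (A : Set N)
      (v : α → N) (xs : Fin n → N), (∀ i, v i ∈ A) → (∀ i, xs i ∈ A) →
      t.realize (Sum.elim v xs) ∈ A ∧
      t.realize (Sum.elim (h ∘ v) (h ∘ xs)) = h (t.realize (Sum.elim v xs)) := by
    intro n t h A v xs hv hxs
    cases t with
    | var i =>
      rcases i with i | i
      · exact ⟨hv i, rfl⟩
      · exact ⟨hxs i, rfl⟩
    | func F _ => exact isEmptyElim F
  have hlow := generic_low' L hgen
  induction φ with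
  | falsum => intros; rfl
  | equal t₁ t₂ =>
    intro h A hA hp hA' v xs hv hxs
    obtain ⟨h1, h2⟩ := hterm t₁ h A v xs hv hxs
    obtain ⟨h3, h4⟩ := hterm t₂ h A v xs hv hxs
    simp only [Language.BoundedFormula.Realize, h2, h4]
    exact ⟨fun e => by rw [e], fun e => hp.1 h1 h3 e⟩
  | rel R ts =>
    intro h A hA hp hA' v xs hv hxs
    simp only [Language.BoundedFormula.Realize]
    have h1 := hp.2 _ R (fun i => (ts i).realize (Sum.elim v xs))
      (fun i => (hterm (ts i) h A v xs hv hxs).1)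
    rw [← h1]
    have h2 : (h ∘ fun i => (ts i).realize (Sum.elim v xs)) =
        fun i => (ts i).realize (Sum.elim (h ∘ v) (h ∘ xs)) :=
      funext fun i => (hterm (ts i) h A v xs hv hxs).2.symm
    rw [h2]
  | imp φ ψ ih1 ih2 =>
    intro h A hA hp hA' v xs hv hxs
    simp only [Language.BoundedFormula.Realize]
    rw [ih1 h A hA hp hA' v xs hv hxs, ih2 h A hA hp hA' v xs hv hxs]
  | @all l φ ih =>
    intro h A hA hp hA' v xs hv hxs
    simp only [Language.BoundedFormula.Realize]
    have hsn : ∀ (g : N → N) (xs : Fin l → N) (y : N),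
        g ∘ (Fin.snoc xs y : Fin (l + 1) → N) = Fin.snoc (g ∘ xs) (g y) := fun g xs y =>
      Fin.comp_snoc g xs y
    have hmemsn : ∀ (D : Set N) (xs : Fin l → N) (y : N), (∀ i, xs i ∈ D) → y ∈ D →
        ∀ i, (Fin.snoc xs y : Fin (l + 1) → N) i ∈ D := by
      intro D xs y h1 h2 i
      refine Fin.lastCases ?_ (fun j => ?_) i
      · rw [Fin.snoc_last]; exact h2
      · rw [Fin.snoc_castSucc]; exact h1 j
    constructor
    · intro H y'
      obtain ⟨D, hD, hDs, hsub, -⟩ := generic_low L hgen (insert y' (h '' A)) (hA'.1.insert y')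
      obtain ⟨g, hg1, hg2, hg3⟩ := generic_ext L hgen hA h hp hD
        (hA'.selfSuffIn L ((Set.subset_insert _ _).trans hsub))
        (fun X hX => hlow X (hD.subset hX))
      have hAD : ∀ x ∈ A, h x ∈ D := fun x hx => hsub (Set.mem_insert_of_mem _ ⟨x, hx, rfl⟩)
      have hyD : y' ∈ D := hsub (Set.mem_insert _ _)
      rw [ih g D (hDs.closed L hD) hg1 hg2 (h ∘ v) (Fin.snoc (h ∘ xs) y')
        (fun i => hAD _ (hv i)) (hmemsn D _ _ (fun i => hAD _ (hxs i)) hyD), hsn]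
      have e1 : g ∘ (h ∘ v) = v := funext fun i => hg3 _ (hv i)
      have e2 : g ∘ (h ∘ xs) = xs := funext fun i => hg3 _ (hxs i)
      rw [e1, e2]
      exact H _
    · intro H y
      obtain ⟨D, hD, hDs, hsub, -⟩ := generic_low L hgen (insert y A) (hA.1.insert y)
      have hl := hp.1.leftInvOn_invFunOn
      have himg : Function.invFunOn h A '' (h '' A) = A := hl.image_image
      obtain ⟨g, hg1, hg2, hg3⟩ := generic_ext L hgen hA' (Function.invFunOn h A) (hp.inv L) hD
        (by rw [himg]; exact (hA.selfSuffIn L ((Set.subset_insert _ _).trans hsub)))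
        (fun X hX => hlow X (hD.subset hX))
      have hgh : ∀ x ∈ A, g x = h x := fun x hx => by
        have := hg3 (h x) ⟨x, hx, rfl⟩
        rwa [hl hx] at this
      have hAD : ∀ x ∈ A, x ∈ D := fun x hx => hsub (Set.mem_insert_of_mem _ hx)
      have hyD : y ∈ D := hsub (Set.mem_insert _ _)
      rw [ih g D (hDs.closed L hD) hg1 hg2 v (Fin.snoc xs y)
        (fun i => hAD _ (hv i)) (hmemsn D _ _ (fun i => hAD _ (hxs i)) hyD), hsn]
      have e1 : g ∘ v = h ∘ v := funext fun i => hgh _ (hv i)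
      have e2 : g ∘ xs = h ∘ xs := funext fun i => hgh _ (hxs i)
      rw [e1, e2]
      exact H _

theorem sameType_of_piso {N : Type} [Nonempty N] [L.Structure N] {f : ℝ → ℝ}
    (hgen : IsGeneric L (N := N) f) {k : ℕ} {h : N → N} {A : Set N} (hA : Closed L A)
    (hp : PIso L h A) (hA' : Closed L (h '' A)) (v : Fin k → N) (hv : ∀ i, v i ∈ A) :
    sameType L (h ∘ v) v := by
  intro φ
  have := back_and_forth L hgen φ h A hA hp hA' v default hv (fun i => i.elim0)
  rw [Language.Formula.Realize, Language.Formula.Realize, this]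
  exact iff_of_eq (congrArg _ (Subsingleton.elim _ _))
end
end Part3

section Part4
theorem star_numeric {f g : ℝ → ℝ} (hf : IsGoodFun f g)
    (hg : ∀ x ∈ Set.Ici (0 : ℝ), g x ≤ 1 / (2 * (x + 1))) {ι : Type} [Fintype ι]
    (e0 eA κ t : ℕ) (s : ι → ℕ) (dE dA d0 : ℤ) (di : ι → ℤ) (he : e0 ≤ eA) (hκ : κ ≤ 1)
    (hE : dA + ∑ i, di i + κ - t ≤ dE) (hfA : f eA ≤ dA)
    (hfi : ∀ i, f ((e0 + s i : ℕ) : ℝ) ≤ ((d0 + di i : ℤ) : ℝ))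
    (hdi : ∀ i, 0 ≤ di i) (hdi' : ∀ i, s i ≠ 0 → 1 ≤ di i) (htA : (t : ℤ) ≤ dA - d0)
    (hA : e0 < eA → 1 ≤ dA - d0)
    (htq : t ≤ (Finset.univ.filter fun i => s i ≠ 0).card) (hκt : κ = 0 → t = 0) :
    f ((eA + ∑ i, s i + κ : ℕ) : ℝ) ≤ (dE : ℝ) := by
  classical
  set J := Finset.univ.filter fun i => s i ≠ 0 with hJ
  set q := J.card with hq
  have hsumJ : ∑ i, s i = ∑ i ∈ J, s i := (Finset.sum_filter_ne_zero _).symm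
  have hQ : (q : ℤ) ≤ ∑ i, di i := by
    calc (q : ℤ) = ∑ i ∈ J, 1 := by simp [hq]
      _ ≤ ∑ i ∈ J, di i := Finset.sum_le_sum fun i hi => hdi' i (Finset.mem_filter.1 hi).2
      _ ≤ ∑ i, di i := Finset.sum_le_sum_of_subset_of_nonneg (Finset.subset_univ _)
          fun i _ _ => hdi i
  set S := ∑ i, s i with hS
  by_cases hcase : S + 1 ≤ 2 * (eA + 1)
  · by_cases h0 : q = 0 ∧ κ = 0
    · obtain ⟨h1, h2⟩ := h0
      have : S = 0 := by
        rw [hsumJ, Finset.card_eq_zero.1 h1]; simp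
      have ht := hκt h2
      rw [this, h2]
      simp only [add_zero]
      refine hfA.trans ?_
      have : dA ≤ dE := by omega
      exact_mod_cast this
    · have h1 := good_slope_nat hf hg (x := eA) (y := eA + S + κ) (q := 1) (by omega) (by omega)
      have h2 : dA + 1 ≤ dE := by
        by_cases hk : κ = 0
        · have := hκt hk
          omega
        · omega
      have h3 : (dA : ℝ) + 1 ≤ dE := by exact_mod_cast h2
      push_cast at h1 ⊢
      linarith
  · have hJne : J.Nonempty := by
      by_contra hne
      rw [Finset.not_nonempty_iff_eq_empty] at hne
      rw [hne] at hsumJ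
      simp at hsumJ
      omega
    obtain ⟨j, hj, hmax⟩ := Finset.exists_max_image J s hJne
    have hsle : S ≤ q * s j := by
      rw [hsumJ, hq, ← smul_eq_mul]
      exact Finset.sum_le_card_nsmul _ _ _ hmax
    have hq1 : 1 ≤ q := Finset.card_pos.2 hJne
    have hQ' : di j + ((q : ℤ) - 1) ≤ ∑ i, di i := by
      calc di j + ((q : ℤ) - 1) = di j + ∑ i ∈ J.erase j, 1 := by
            have h1 : ((J.erase j).card : ℤ) = q - 1 := by
              rw [Finset.card_erase_of_mem hj]; omega
            rw [Finset.sum_const, nsmul_eq_mul, mul_one, h1]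
        _ ≤ di j + ∑ i ∈ J.erase j, di i := by
            gcongr with i hi
            exact hdi' i (Finset.mem_filter.1 (Finset.mem_of_mem_erase hi)).2
        _ = ∑ i ∈ J, di i := Finset.add_sum_erase _ _ hj
        _ ≤ ∑ i, di i := Finset.sum_le_sum_of_subset_of_nonneg (Finset.subset_univ _)
          fun i _ _ => hdi i
    have hjS : s j ≤ S := Finset.single_le_sum (f := s) (fun _ _ => Nat.zero_le _) (Finset.mem_univ j)
    have hexp : 2 * q * (e0 + s j + 1) = 2 * (q * e0) + 2 * (q * s j) + 2 * q := by ring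
    have hfin : ∀ p : ℕ, eA + S + κ ≤ e0 + s j + 2 * p * (e0 + s j + 1) →
        (p : ℤ) ≤ dE - (d0 + di j) → f ((eA + S + κ : ℕ) : ℝ) ≤ (dE : ℝ) := by
      intro p h1 h2
      have h3 := good_slope_nat hf hg (x := e0 + s j) (y := eA + S + κ) (q := p) (by omega) h1
      have h4 := hfi j
      have h5 : (p : ℝ) ≤ dE - (d0 + di j) := by exact_mod_cast h2
      push_cast at h3 h4 h5 ⊢
      linarith
    by_cases hk : κ = 1
    · refine hfin q ?_ (by omega)
      rw [hexp]; omega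
    · have hk0 : κ = 0 := by omega
      have ht := hκt hk0
      by_cases heq : e0 < eA
      · have := hA heq
        refine hfin q ?_ (by omega)
        rw [hexp]; omega
      · refine hfin (q - 1) ?_ (by omega)
        obtain ⟨q', hq'⟩ : ∃ q', q = q' + 1 := ⟨q - 1, by omega⟩
        rw [hq'] at hsle ⊢
        have e1 : (q' + 1) * s j = q' * s j + s j := by ring
        have e2 : 2 * (q' + 1 - 1) * (e0 + s j + 1) = 2 * (q' * e0) + 2 * (q' * s j) + 2 * q' := by
          simp; ring
        rw [e2]
        omega
end Part4

section Part5
/-- Carrier of the star amalgam: a new point `none`, a copy of `N` tagged `none`, and a copy of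
`N` for every index `i`. -/
def StarT {N ι : Type} (_R3 : L.Relations 3) (_C : Set N) (_b : N) (_y : ι → N) : Type :=
  Option (Option ι × N)

section star
variable {N ι : Type} (R3 : L.Relations 3) (C : Set N) (b : N) (y : ι → N)

/-- base inclusion -/
def starA (x : N) : StarT L R3 C b y := some (none, x)

open Classical in
/-- inclusion of the `i`-th copy, glued along `C` -/
noncomputable def starI (i : ι) (x : N) : StarT L R3 C b y :=
  some (if x ∈ C then none else some i, x)

/-- the new point -/
def starC : StarT L R3 C b y := none

/-- the special relation instance -/
noncomputable def starSp (i : ι) : Σ n, L.Relations n × (Fin n → StarT L R3 C b y) :=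
  ⟨3, R3, ![starC L R3 C b y, starI L R3 C b y i b, starA L R3 C b y (y i)]⟩

noncomputable instance starStr [L.IsRelational] [L.Structure N] :
    L.Structure (StarT L R3 C b y) where
  funMap := fun {_} F => isEmptyElim F
  RelMap := fun {n} R v =>
    (∃ w : Fin n → N, v = starA L R3 C b y ∘ w ∧ Language.Structure.RelMap R w) ∨
    (∃ i, ∃ w : Fin n → N, v = starI L R3 C b y i ∘ w ∧ Language.Structure.RelMap R w) ∨
    (∃ i, (⟨n, R, v⟩ : Σ n, L.Relations n × (Fin n → StarT L R3 C b y)) = starSp L R3 C b y i)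

/-- the finite part of interest -/
def starB (A D : Set N) : Set (StarT L R3 C b y) :=
  insert (starC L R3 C b y) (starA L R3 C b y '' A ∪ ⋃ i, starI L R3 C b y i '' D)

theorem starA_inj : Function.Injective (starA L R3 C b y) := by
  intro x x' h
  simp only [starA] at h
  exact (Prod.mk.inj (Option.some.inj h)).2

theorem starI_of_mem {i : ι} {x : N} (h : x ∈ C) :
    starI L R3 C b y i x = starA L R3 C b y x :=
  congrArg (fun o : Option ι => (some (o, x) : Option (Option ι × N))) (if_pos h)

theorem starI_of_not_mem {i : ι} {x : N} (h : x ∉ C) :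
    starI L R3 C b y i x = (some (some i, x) : Option (Option ι × N)) :=
  congrArg (fun o : Option ι => (some (o, x) : Option (Option ι × N))) (if_neg h)

theorem starI_eq_starA {i : ι} {x x' : N} (h : starI L R3 C b y i x = starA L R3 C b y x') :
    x = x' ∧ x ∈ C := by
  refine ⟨(Prod.mk.inj (Option.some.inj h)).2, ?_⟩
  by_contra hx
  have h2 := (starI_of_not_mem L R3 C b y hx (i := i)).symm.trans h
  have h3 := (Prod.mk.inj (Option.some.inj h2)).1
  exact Option.some_ne_none _ h3

theorem starI_eq_starI {i j : ι} {x x' : N} (h : starI L R3 C b y i x = starI L R3 C b y j x') :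
    x = x' :=
  (Prod.mk.inj (Option.some.inj h)).2

theorem starI_eq_starI' {i j : ι} {x x' : N} (h : starI L R3 C b y i x = starI L R3 C b y j x')
    (hx : x ∉ C) : i = j := by
  have h1 := starI_eq_starI L R3 C b y h
  subst h1
  have h2 := (starI_of_not_mem L R3 C b y hx (i := i)).symm.trans
    (h.trans (starI_of_not_mem L R3 C b y hx (i := j)))
  exact Option.some.inj (Prod.mk.inj (Option.some.inj h2)).1

theorem starI_ne_starC {i : ι} {x : N} : starI L R3 C b y i x ≠ starC L R3 C b y :=
  Option.some_ne_none _

theorem starA_ne_starC {x : N} : starA L R3 C b y x ≠ starC L R3 C b y :=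
  Option.some_ne_none _

theorem starSp_inj : Set.InjOn (starSp L R3 C b y) {_i | b ∉ C} := by
  intro i hi j hj h
  simp only [starSp, Sigma.mk.injEq, heq_eq_eq, Prod.mk.injEq, true_and] at h
  have := congrFun h 1
  exact starI_eq_starI' L R3 C b y this hi

theorem starSp_mem {i : ι} {E : Set (StarT L R3 C b y)} {n : ℕ} {R : L.Relations n}
    {v : Fin n → StarT L R3 C b y} (hv : ∀ j, v j ∈ E)
    (h : (⟨n, R, v⟩ : Σ n, L.Relations n × (Fin n → StarT L R3 C b y)) = starSp L R3 C b y i) :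
    starC L R3 C b y ∈ E ∧ starI L R3 C b y i b ∈ E ∧ starA L R3 C b y (y i) ∈ E := by
  simp only [starSp, Sigma.mk.injEq] at h
  obtain ⟨rfl, h⟩ := h
  simp only [heq_eq_eq, Prod.mk.injEq] at h
  obtain ⟨rfl, rfl⟩ := h
  exact ⟨hv 0, hv 1, hv 2⟩

variable [L.IsRelational] [L.Structure N]

theorem starA_piso (A : Set N) : PIso L (starA L R3 C b y) A := by
  refine ⟨(starA_inj L R3 C b y).injOn, fun n R v _ => ⟨?_, fun h => Or.inl ⟨v, rfl, h⟩⟩⟩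
  rintro (⟨w, hw, hR⟩ | ⟨i, w, hw, hR⟩ | ⟨i, hi⟩)
  · have : v = w := funext fun j => starA_inj L R3 C b y (congrFun hw j)
    rwa [this]
  · have : w = v := funext fun j => (starI_eq_starA L R3 C b y (congrFun hw j).symm).1
    rwa [← this]
  · exfalso
    have := starSp_mem L R3 C b y (E := Set.range (starA L R3 C b y)) (fun j => ⟨v j, rfl⟩) hi
    obtain ⟨x, hx⟩ := this.1
    exact starA_ne_starC L R3 C b y hx

theorem starI_piso (i : ι) (D : Set N) : PIso L (starI L R3 C b y i) D := by
  refine ⟨fun _ _ _ _ h => starI_eq_starI L R3 C b y h,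
    fun n R v _ => ⟨?_, fun h => Or.inr (Or.inl ⟨i, v, rfl, h⟩)⟩⟩
  rintro (⟨w, hw, hR⟩ | ⟨i', w, hw, hR⟩ | ⟨i', hi⟩)
  · have : v = w := funext fun j => (starI_eq_starA L R3 C b y (congrFun hw j)).1
    rwa [this]
  · have : v = w := funext fun j => starI_eq_starI L R3 C b y (congrFun hw j)
    rwa [this]
  · exfalso
    have := starSp_mem L R3 C b y (E := Set.range (starI L R3 C b y i)) (fun j => ⟨v j, rfl⟩) hi
    obtain ⟨x, hx⟩ := this.1
    exact starI_ne_starC L R3 C b y hx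

theorem starRel (i : ι) : Language.Structure.RelMap R3
    ![starC L R3 C b y, starI L R3 C b y i b, starA L R3 C b y (y i)] :=
  Or.inr (Or.inr ⟨i, rfl⟩)

end star

section count
variable {N ι : Type} [Fintype ι] (R3 : L.Relations 3) (C : Set N) (b : N) (y : ι → N)

open Classical in
theorem star_card {A D : Set N} (hCA : C ⊆ A) (hA : A.Finite) (hD : D.Finite)
    {E : Set (StarT L R3 C b y)} (hE : E ⊆ starB L R3 C b y A D) :
    E.ncard = (starA L R3 C b y ⁻¹' E).ncard
      + ∑ i, ((starI L R3 C b y i ⁻¹' E) \ C).ncard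
      + (if starC L R3 C b y ∈ E then 1 else 0) := by
  have hEA : starA L R3 C b y ⁻¹' E ⊆ A := by
    intro x hx
    rcases hE hx with h | ⟨x', hx', h⟩ | h
    · exact absurd h (starA_ne_starC L R3 C b y)
    · rwa [← starA_inj L R3 C b y h]
    · obtain ⟨i, x', hx', h⟩ := Set.mem_iUnion.1 h
      have := starI_eq_starA L R3 C b y h
      rw [← this.1]; exact hCA this.2
  have hEI : ∀ i, (starI L R3 C b y i ⁻¹' E) \ C ⊆ D := by
    rintro i x ⟨hx, hxC⟩
    rcases hE hx with h | ⟨x', hx', h⟩ | h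
    · exact absurd h (starI_ne_starC L R3 C b y)
    · exact absurd (starI_eq_starA L R3 C b y h.symm).2 hxC
    · obtain ⟨j, x', hx', h⟩ := Set.mem_iUnion.1 h
      rwa [← starI_eq_starI L R3 C b y h]
  have hdec : E = (starA L R3 C b y '' (starA L R3 C b y ⁻¹' E) ∪
      ⋃ i, starI L R3 C b y i '' ((starI L R3 C b y i ⁻¹' E) \ C)) ∪
      (if starC L R3 C b y ∈ E then {starC L R3 C b y} else ∅) := by
    apply Set.Subset.antisymm
    · intro x hx
      rcases hE hx with h | ⟨x', hx', rfl⟩ | h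
      · right
        rw [h] at hx
        rw [if_pos hx]; exact h
      · exact Or.inl (Or.inl ⟨x', hx, rfl⟩)
      · obtain ⟨i, x', hx', rfl⟩ := Set.mem_iUnion.1 h
        by_cases hc : x' ∈ C
        · left; left
          rw [starI_of_mem L R3 C b y hc] at hx ⊢
          exact ⟨x', hx, rfl⟩
        · exact Or.inl (Or.inr (Set.mem_iUnion.2 ⟨i, x', ⟨hx, hc⟩, rfl⟩))
    · rintro x ((⟨x', hx', rfl⟩ | h) | h)
      · exact hx'
      · obtain ⟨i, x', hx', rfl⟩ := Set.mem_iUnion.1 h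
        exact hx'.1
      · split_ifs at h with hc
        · rw [h]; exact hc
        · exact absurd h (Set.notMem_empty x)
  have hfin1 : (starA L R3 C b y '' (starA L R3 C b y ⁻¹' E)).Finite := (hA.subset hEA).image _
  have hfin2 : ∀ i, (starI L R3 C b y i '' ((starI L R3 C b y i ⁻¹' E) \ C)).Finite :=
    fun i => (hD.subset (hEI i)).image _
  have hfin3 : (if starC L R3 C b y ∈ E then {starC L R3 C b y} else ∅ :
      Set (StarT L R3 C b y)).Finite := by
    split_ifs
    · exact Set.finite_singleton _
    · exact Set.finite_empty
  rw [hdec, Set.ncard_union_eq _ (hfin1.union (Set.finite_iUnion hfin2)) hfin3,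
    Set.ncard_union_eq _ hfin1 (Set.finite_iUnion hfin2), ← hdec]
  · congr 1
    · congr 1
      · exact Set.ncard_image_of_injective _ (starA_inj L R3 C b y)
      · rw [Set.ncard_iUnion_of_finite hfin2, finsum_eq_sum_of_fintype]
        · refine Finset.sum_congr rfl fun i _ => ?_
          exact Set.ncard_image_of_injective _ fun _ _ h => starI_eq_starI L R3 C b y h
        · intro i j hij
          refine Set.disjoint_left.2 ?_
          rintro _ ⟨x, hx, rfl⟩ ⟨x', hx', h⟩
          exact hij (starI_eq_starI' L R3 C b y h.symm hx.2)
    · split_ifs <;> simp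
  · refine Set.disjoint_left.2 ?_
    rintro _ ⟨x, hx, rfl⟩ h
    obtain ⟨i, x', hx', h⟩ := Set.mem_iUnion.1 h
    exact hx'.2 (starI_eq_starA L R3 C b y h).2
  · refine Set.disjoint_left.2 ?_
    intro x hx h
    have hxc : x = starC L R3 C b y := by
      split_ifs at h
      · exact h
      · exact absurd h (Set.notMem_empty x)
    rcases hx with ⟨x', hx', h1⟩ | h1
    · exact starA_ne_starC L R3 C b y (h1.trans hxc)
    · obtain ⟨i, x', hx', h1⟩ := Set.mem_iUnion.1 h1
      exact starI_ne_starC L R3 C b y (h1.trans hxc)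

variable [L.IsRelational] [L.Structure N] [Finite (Σ n, L.Relations n)]

theorem star_rels {EA : Set N} {EI : ι → Set N} {E : Set (StarT L R3 C b y)}
    (hEA : starA L R3 C b y ⁻¹' E = EA) (hEI : ∀ i, starI L R3 C b y i ⁻¹' E = EI i)
    (hfA : EA.Finite) (hfI : ∀ i, (EI i).Finite) :
    ((relsIn L E).ncard : ℤ) ≤ (relsIn L EA).ncard
      + ∑ i, (((relsIn L (EI i)).ncard : ℤ) - (relsIn L (EA ∩ C)).ncard)
      + ({i | starC L R3 C b y ∈ E ∧ b ∈ EI i ∧ y i ∈ EA}.ncard : ℤ) := by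
  have hC : ∀ i, EA ∩ C = EI i ∩ C := by
    intro i
    ext x
    simp only [Set.mem_inter_iff, ← hEA, ← hEI, Set.mem_preimage]
    refine and_congr_left fun hx => ?_
    rw [starI_of_mem L R3 C b y hx]
  have hsub : relsIn L E ⊆ (relPush L (starA L R3 C b y) '' relsIn L EA ∪
      ⋃ i, relPush L (starI L R3 C b y i) '' (relsIn L (EI i) \ relsIn L (EA ∩ C))) ∪
      starSp L R3 C b y '' {i | starC L R3 C b y ∈ E ∧ b ∈ EI i ∧ y i ∈ EA} := by
    rintro ⟨n, R, v⟩ ⟨hv, hR⟩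
    simp only at hv hR
    rcases hR with ⟨w, rfl, hw⟩ | ⟨i, w, rfl, hw⟩ | ⟨i, hi⟩
    · refine Or.inl (Or.inl ⟨⟨n, R, w⟩, ⟨fun j => ?_, hw⟩, rfl⟩)
      rw [← hEA]; exact hv j
    · have hwI : ∀ j, w j ∈ EI i := fun j => by rw [← hEI i]; exact hv j
      by_cases hcc : ∀ j, w j ∈ C
      · refine Or.inl (Or.inl ⟨⟨n, R, w⟩, ⟨fun j => ?_, hw⟩, ?_⟩)
        · have : w j ∈ EA ∩ C := by rw [hC i]; exact ⟨hwI j, hcc j⟩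
          exact this.1
        · have : starA L R3 C b y ∘ w = starI L R3 C b y i ∘ w :=
            funext fun j => (starI_of_mem L R3 C b y (hcc j)).symm
          simp only [relPush, this]
      · refine Or.inl (Or.inr (Set.mem_iUnion.2 ⟨i, ⟨n, R, w⟩, ⟨⟨hwI, hw⟩, fun h => ?_⟩, rfl⟩))
        exact hcc fun j => (h.1 j).2
    · refine Or.inr ⟨i, ?_, hi.symm⟩
      have := starSp_mem L R3 C b y hv hi
      refine ⟨this.1, ?_, ?_⟩
      · rw [← hEI i]; exact this.2.1
      · rw [← hEA]; exact this.2.2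
  have hn1 : (relPush L (starA L R3 C b y) '' relsIn L EA).ncard ≤ (relsIn L EA).ncard :=
    Set.ncard_image_le (relsIn_finite L hfA)
  have hfI' : ∀ i, (relsIn L (EI i) \ relsIn L (EA ∩ C)).Finite :=
    fun i => (relsIn_finite L (hfI i)).sdiff
  have hn2 : (⋃ i, relPush L (starI L R3 C b y i) ''
      (relsIn L (EI i) \ relsIn L (EA ∩ C))).ncard ≤
      ∑ i, (relsIn L (EI i) \ relsIn L (EA ∩ C)).ncard :=
    (Set.ncard_iUnion_le_of_fintype _).trans
      (Finset.sum_le_sum fun i _ => Set.ncard_image_le (hfI' i))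
  have hn3 : (starSp L R3 C b y '' {i | starC L R3 C b y ∈ E ∧ b ∈ EI i ∧ y i ∈ EA}).ncard ≤
      {i | starC L R3 C b y ∈ E ∧ b ∈ EI i ∧ y i ∈ EA}.ncard :=
    Set.ncard_image_le (Set.toFinite _)
  have hn4 : ∀ i, ((relsIn L (EI i) \ relsIn L (EA ∩ C)).ncard : ℤ) =
      ((relsIn L (EI i)).ncard : ℤ) - (relsIn L (EA ∩ C)).ncard := by
    intro i
    have h1 : relsIn L (EA ∩ C) ⊆ relsIn L (EI i) := by
      rw [hC i]; exact relsIn_mono L Set.inter_subset_left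
    have h2 := Set.ncard_sdiff_add_ncard_of_subset h1 (relsIn_finite L (hfI i))
    omega
  have hn5 := Set.ncard_le_ncard hsub (((((relsIn_finite L hfA).image _).union
    (Set.finite_iUnion fun i => (hfI' i).image _))).union ((Set.toFinite _).image _))
  have hn6 := hn5.trans (Set.ncard_union_le _ _)
  have hn7 := Set.ncard_union_le (relPush L (starA L R3 C b y) '' relsIn L EA)
    (⋃ i, relPush L (starI L R3 C b y i) '' (relsIn L (EI i) \ relsIn L (EA ∩ C)))
  have hn8 : (∑ i, (((relsIn L (EI i)).ncard : ℤ) - (relsIn L (EA ∩ C)).ncard)) =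
      ((∑ i, (relsIn L (EI i) \ relsIn L (EA ∩ C)).ncard : ℕ) : ℤ) := by
    push_cast
    exact Finset.sum_congr rfl fun i _ => (hn4 i).symm
  rw [hn8]
  omega
end count
end Part5

section Part6
set_option linter.unusedSectionVars false
section facts
variable {N ι : Type} [Fintype ι] (R3 : L.Relations 3) (C : Set N) (b : N) (y : ι → N)
variable [L.IsRelational] [L.Structure N] [Finite (Σ n, L.Relations n)]

theorem indep_rel {N ι : Type} [Finite ι] [L.Structure N] {C : Set N} (hC : C.Finite) (y : ι → N)
    (hind : ∀ E : Set N, E.Finite → C ⊆ E → delta L C + ({i | y i ∈ E}.ncard : ℤ) ≤ delta L E)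
    {E : Set N} (hE : E.Finite) :
    delta L (E ∩ C) + ({i | y i ∈ E}.ncard : ℤ) ≤ delta L E := by
  have h1 := hind (E ∪ C) (hE.union hC) Set.subset_union_right
  have h2 := delta_submod L hE hC
  have h3 : {i | y i ∈ E}.ncard ≤ {i | y i ∈ E ∪ C}.ncard :=
    Set.ncard_le_ncard (fun i hi => Or.inl hi) (Set.toFinite _)
  omega

/-- the numerical information about a subset `E` of the star amalgam -/
structure StarFacts (A D : Set N) (E : Set (StarT L R3 C b y)) (EA : Set N) (EI : ι → Set N)
    (κ t : ℕ) : Prop where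
  hEA : starA L R3 C b y ⁻¹' E = EA
  hEI : ∀ i, starI L R3 C b y i ⁻¹' E = EI i
  subA : EA ⊆ A
  subD : ∀ i, EI i ⊆ D
  hC : ∀ i, EA ∩ C = EI i ∩ C
  card : E.ncard = EA.ncard + ∑ i, (EI i \ C).ncard + κ
  dE : delta L EA + ∑ i, (delta L (EI i) - delta L (EA ∩ C)) + κ - t ≤ delta L E
  kap : κ ≤ 1
  nonneg : ∀ i, 0 ≤ delta L (EI i) - delta L (EA ∩ C)
  pos : ∀ i, (EI i \ C).ncard ≠ 0 → 1 ≤ delta L (EI i) - delta L (EA ∩ C)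
  tA : (t : ℤ) ≤ delta L EA - delta L (EA ∩ C)
  posA : (EA ∩ C).ncard < EA.ncard → 1 ≤ delta L EA - delta L (EA ∩ C)
  tq : t ≤ (Finset.univ.filter fun i => (EI i \ C).ncard ≠ 0).card
  kt : κ = 0 → t = 0

theorem star_facts {A D : Set N} (hC : Closed L C) (hCA : C ⊆ A) (hCD : C ⊆ D) (hA : A.Finite)
    (hD : D.Finite) (hb : b ∉ C)
    (hind : ∀ E : Set N, E.Finite → C ⊆ E → delta L C + ({i | y i ∈ E}.ncard : ℤ) ≤ delta L E)
    {E : Set (StarT L R3 C b y)} (hE : E ⊆ starB L R3 C b y A D) :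
    ∃ EA EI κ t, StarFacts L R3 C b y A D E EA EI κ t := by
  classical
  obtain ⟨EA, hEA⟩ : ∃ EA, starA L R3 C b y ⁻¹' E = EA := ⟨_, rfl⟩
  obtain ⟨EI, hEI⟩ : ∃ EI : ι → Set N, ∀ i, starI L R3 C b y i ⁻¹' E = EI i :=
    ⟨_, fun i => rfl⟩
  have subA : EA ⊆ A := by
    intro x hx
    rw [← hEA] at hx
    rcases hE hx with h | ⟨x', hx', h⟩ | h
    · exact absurd h (starA_ne_starC L R3 C b y)
    · rwa [← starA_inj L R3 C b y h]
    · obtain ⟨i, x', hx', h⟩ := Set.mem_iUnion.1 h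
      have := starI_eq_starA L R3 C b y h
      rw [← this.1]; exact hCA this.2
  have subD : ∀ i, EI i ⊆ D := by
    intro i x hx
    by_cases hxC : x ∈ C
    · exact hCD hxC
    rw [← hEI] at hx
    rcases hE hx with h | ⟨x', hx', h⟩ | h
    · exact absurd h (starI_ne_starC L R3 C b y)
    · exact absurd (starI_eq_starA L R3 C b y h.symm).2 hxC
    · obtain ⟨j, x', hx', h⟩ := Set.mem_iUnion.1 h
      rwa [← starI_eq_starI L R3 C b y h]
  have hCe : ∀ i, EA ∩ C = EI i ∩ C := by
    intro i
    ext x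
    simp only [Set.mem_inter_iff, ← hEA, ← hEI, Set.mem_preimage]
    refine and_congr_left fun hx => ?_
    rw [starI_of_mem L R3 C b y hx]
  have hfA := hA.subset subA
  have hfI := fun i => hD.subset (subD i)
  have hcard := star_card L R3 C b y hCA hA hD hE
  rw [hEA] at hcard
  simp only [hEI] at hcard
  have hrel := star_rels L R3 C b y hEA hEI hfA hfI
  set κ : ℕ := if starC L R3 C b y ∈ E then 1 else 0 with hκ
  set T := {i | starC L R3 C b y ∈ E ∧ b ∈ EI i ∧ y i ∈ EA} with hT
  have hsplit : ∀ i, (EA ∩ C).ncard + (EI i \ C).ncard = (EI i).ncard := by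
    intro i
    rw [hCe i]
    exact Set.ncard_inter_add_ncard_sdiff_eq_ncard _ _ (hfI i)
  refine ⟨EA, EI, κ, T.ncard, hEA, hEI, subA, subD, hCe, hcard, ?_, ?_, ?_, ?_, ?_, ?_, ?_, ?_⟩
  · have h1 : ∑ i, (delta L (EI i) - delta L (EA ∩ C)) = (∑ i, ((EI i \ C).ncard : ℤ)) -
        ∑ i, (((relsIn L (EI i)).ncard : ℤ) - (relsIn L (EA ∩ C)).ncard) := by
      rw [← Finset.sum_sub_distrib]
      refine Finset.sum_congr rfl fun i _ => ?_
      have := hsplit i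
      simp only [delta_eq]
      omega
    have h2 : (E.ncard : ℤ) = EA.ncard + (∑ i, ((EI i \ C).ncard : ℤ)) + κ := by
      rw [hcard]; push_cast; rfl
    rw [h1, delta_eq L E, delta_eq L EA, h2]
    omega
  · rw [hκ]; split_ifs <;> simp
  · intro i
    have := hC.rel_le L (hfI i)
    rw [hCe i]; omega
  · intro i hi
    have : ¬ EI i ⊆ C := fun h => hi (by rw [Set.sdiff_eq_empty.2 h]; simp)
    have := hC.rel_lt L (hfI i) this
    rw [hCe i]; omega
  · have h1 := indep_rel L hC.1 y hind hfA
    have h2 : T.ncard ≤ {i | y i ∈ EA}.ncard :=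
      Set.ncard_le_ncard (fun i hi => hi.2.2) (Set.toFinite _)
    omega
  · intro h
    have : ¬ EA ⊆ C := fun h' => by rw [Set.inter_eq_left.2 h'] at h; omega
    have := hC.rel_lt L hfA this
    omega
  · rw [← Set.ncard_coe_finset]
    refine Set.ncard_le_ncard ?_ (Set.toFinite _)
    intro i hi
    simp only [Finset.coe_filter, Finset.mem_univ, true_and, Set.mem_ofPred_eq]
    have hne : (EI i \ C).Nonempty := ⟨b, hi.2.1, hb⟩
    exact ((Set.ncard_pos ((hfI i).sdiff)).2 hne).ne'
  · intro h
    have h1 : starC L R3 C b y ∉ E := fun h' => by rw [hκ, if_pos h'] at h; omega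
    have : T = ∅ := Set.eq_empty_of_forall_notMem fun i hi => h1 hi.1
    rw [this]; simp

theorem StarFacts.sum_ge {A D : Set N} {E : Set (StarT L R3 C b y)} {EA : Set N} {EI : ι → Set N}
    {κ t : ℕ} (h : StarFacts L R3 C b y A D E EA EI κ t) :
    ((Finset.univ.filter fun i => (EI i \ C).ncard ≠ 0).card : ℤ) ≤
      ∑ i, (delta L (EI i) - delta L (EA ∩ C)) := by
  classical
  set J := Finset.univ.filter fun i => (EI i \ C).ncard ≠ 0
  calc (J.card : ℤ) = ∑ i ∈ J, 1 := by simp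
      _ ≤ ∑ i ∈ J, (delta L (EI i) - delta L (EA ∩ C)) :=
        Finset.sum_le_sum fun i hi => h.pos i (Finset.mem_filter.1 hi).2
      _ ≤ _ := Finset.sum_le_sum_of_subset_of_nonneg (Finset.subset_univ _)
          fun i _ _ => h.nonneg i

theorem starB_finite {A D : Set N} (hA : A.Finite) (hD : D.Finite) :
    (starB L R3 C b y A D).Finite :=
  ((hA.image _).union (Set.finite_iUnion fun _ => hD.image _)).insert _

theorem star_A_le {A D : Set N} (hC : Closed L C) (hCA : C ⊆ A) (hCD : C ⊆ D) (hA : A.Finite)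
    (hD : D.Finite) (hb : b ∉ C)
    (hind : ∀ E : Set N, E.Finite → C ⊆ E → delta L C + ({i | y i ∈ E}.ncard : ℤ) ≤ delta L E) :
    SelfSuffIn L (starA L R3 C b y '' A) (starB L R3 C b y A D) := by
  refine ⟨fun x hx => Or.inr (Or.inl hx), fun E h1 h2 h3 => ?_⟩
  obtain ⟨EA, EI, κ, t, F⟩ := star_facts L R3 C b y hC hCA hCD hA hD hb hind h2
  have hEA : EA = A := by
    refine Set.Subset.antisymm F.subA fun x hx => ?_
    rw [← F.hEA]; exact h1.1 ⟨x, hx, rfl⟩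
  subst hEA
  rw [(starA_piso L R3 C b y EA).delta_image]
  have h4 := F.sum_ge
  have h5 := F.tq
  have h6 := F.dE
  by_cases hk : κ = 0
  · have h7 := F.kt hk
    have h8 := Set.ncard_lt_ncard h1 h3
    rw [Set.ncard_image_of_injective _ (starA_inj L R3 C b y), F.card] at h8
    have h9 : 0 < (Finset.univ.filter fun i => (EI i \ C).ncard ≠ 0).card := by
      rw [Finset.card_pos]
      obtain ⟨i, hi, hi'⟩ := Finset.exists_ne_zero_of_sum_ne_zero
        (show ∑ i, (EI i \ C).ncard ≠ 0 by omega)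
      exact ⟨i, Finset.mem_filter.2 ⟨hi, hi'⟩⟩
    omega
  · omega

theorem star_D_le {A D : Set N} (hC : Closed L C) (hCA : C ⊆ A) (hCD : C ⊆ D) (hA : A.Finite)
    (hD : D.Finite) (hb : b ∉ C)
    (hind : ∀ E : Set N, E.Finite → C ⊆ E → delta L C + ({i | y i ∈ E}.ncard : ℤ) ≤ delta L E)
    (j : ι) :
    SelfSuffIn L (starI L R3 C b y j '' D) (starB L R3 C b y A D) := by
  classical
  refine ⟨fun x hx => Or.inr (Or.inr (Set.mem_iUnion.2 ⟨j, hx⟩)), fun E h1 h2 h3 => ?_⟩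
  obtain ⟨EA, EI, κ, t, F⟩ := star_facts L R3 C b y hC hCA hCD hA hD hb hind h2
  have hEI : EI j = D := by
    refine Set.Subset.antisymm (F.subD j) fun x hx => ?_
    rw [← F.hEI]; exact h1.1 ⟨x, hx, rfl⟩
  have hE0 : EA ∩ C = C := by rw [F.hC j, hEI]; exact Set.inter_eq_right.2 hCD
  rw [(starI_piso L R3 C b y j D).delta_image]
  have h4 : delta L (EI j) - delta L (EA ∩ C) ≤ _ :=
    Finset.single_le_sum (f := fun i => delta L (EI i) - delta L (EA ∩ C))
      (fun i _ => F.nonneg i) (Finset.mem_univ j)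
  have h5 := F.tq
  have h6 := F.dE
  have h10 := F.tA
  have h11 := F.posA
  rw [hEI, hE0] at h4
  rw [hE0] at h6 h10 h11
  by_cases hk : κ = 0
  · have h7 := F.kt hk
    have h8 := Set.ncard_lt_ncard h1 h3
    rw [Set.ncard_image_of_injective _ (fun _ _ h => starI_eq_starI L R3 C b y h), F.card] at h8
    have hs := Finset.add_sum_erase Finset.univ (fun i => (EI i \ C).ncard) (Finset.mem_univ j)
    have hsp := Set.ncard_sdiff_add_ncard_of_subset hCD hD
    have hCle : C.ncard ≤ EA.ncard :=
      Set.ncard_le_ncard (Set.inter_eq_right.1 hE0) (hA.subset F.subA)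
    simp only [hEI] at hs
    have hs' := Finset.add_sum_erase Finset.univ
      (fun i => delta L (EI i) - delta L C) (Finset.mem_univ j)
    simp only [hEI] at hs'
    by_cases hz : ∑ i ∈ Finset.univ.erase j, (EI i \ C).ncard = 0
    · have := h11 (by omega)
      have hnn : 0 ≤ ∑ i ∈ Finset.univ.erase j, (delta L (EI i) - delta L C) :=
        Finset.sum_nonneg fun i _ => by have := F.nonneg i; rwa [hE0] at this
      omega
    · obtain ⟨i, hi, hi'⟩ := Finset.exists_ne_zero_of_sum_ne_zero hz
      have h12 := F.pos i hi'
      rw [hE0] at h12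
      have hnn : delta L (EI i) - delta L C ≤
          ∑ i ∈ Finset.univ.erase j, (delta L (EI i) - delta L C) :=
        Finset.single_le_sum (f := fun i => delta L (EI i) - delta L C)
          (fun i _ => by have := F.nonneg i; rwa [hE0] at this) hi
      omega
  · omega

theorem star_Kf {f g : ℝ → ℝ} (hf : IsGoodFun f g)
    (hg : ∀ x ∈ Set.Ici (0 : ℝ), g x ≤ 1 / (2 * (x + 1)))
    (hlow : ∀ X : Set N, X.Finite → f X.ncard ≤ (delta L X : ℝ))
    {A D : Set N} (hC : Closed L C) (hCA : C ⊆ A) (hCD : C ⊆ D) (hA : A.Finite)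
    (hD : D.Finite) (hb : b ∉ C)
    (hind : ∀ E : Set N, E.Finite → C ⊆ E → delta L C + ({i | y i ∈ E}.ncard : ℤ) ≤ delta L E)
    {E : Set (StarT L R3 C b y)} (hE : E ⊆ starB L R3 C b y A D) :
    f E.ncard ≤ (delta L E : ℝ) := by
  obtain ⟨EA, EI, κ, t, F⟩ := star_facts L R3 C b y hC hCA hCD hA hD hb hind hE
  rw [F.card]
  have hfA := hA.subset F.subA
  refine star_numeric hf hg (EA ∩ C).ncard EA.ncard κ t (fun i => (EI i \ C).ncard) _
    (delta L EA) (delta L (EA ∩ C)) (fun i => delta L (EI i) - delta L (EA ∩ C))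
    (Set.ncard_le_ncard Set.inter_subset_left hfA) F.kap F.dE (hlow _ hfA) ?_ F.nonneg F.pos
    F.tA F.posA F.tq F.kt
  intro i
  have hfI := hD.subset (F.subD i)
  have h1 : (EA ∩ C).ncard + (EI i \ C).ncard = (EI i).ncard := by
    rw [F.hC i]
    exact Set.ncard_inter_add_ncard_sdiff_eq_ncard _ _ hfI
  rw [h1, add_sub_cancel]
  exact hlow _ hfI

end facts

/-- the main amalgamation claim -/
theorem star_claim {N : Type} [Nonempty N] [L.IsRelational] [L.Structure N]
    [Finite (Σ n, L.Relations n)] (R3 : L.Relations 3) {f g : ℝ → ℝ} (hf : IsGoodFun f g)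
    (hg : ∀ x ∈ Set.Ici (0 : ℝ), g x ≤ 1 / (2 * (x + 1))) (hgen : IsGeneric L (N := N) f)
    {k : ℕ} (a : Fin k → N) (b : N) (hb : b ∉ clM L (Set.range a))
    {ι : Type} [Fintype ι] (y : ι → N)
    (hind : ∀ E : Set N, E.Finite → clM L (Set.range a) ⊆ E →
      delta L (clM L (Set.range a)) + ({i | y i ∈ E}.ncard : ℤ) ≤ delta L E) :
    ∃ c : N, ∃ z : ι → N, ∀ i, sameType L (Fin.snoc a (z i) : Fin (k + 1) → N) (Fin.snoc a b) ∧
      Language.Structure.RelMap R3 ![c, z i, y i] := by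
  have hlow := generic_low' L hgen
  have hcl := exists_closure L hf.mono hf.unbounded hlow
  set C := clM L (Set.range a) with hCdef
  obtain ⟨hC1, hC2, -⟩ := hcl (Set.range a) (Set.finite_range a)
  obtain ⟨hA1, hA2, -⟩ := hcl (C ∪ Set.range y) (hC1.1.union (Set.finite_range y))
  obtain ⟨hD1, hD2, -⟩ := hcl (insert b C) (hC1.1.insert b)
  set A := clM L (C ∪ Set.range y)
  set D := clM L (insert b C)
  have hCA : C ⊆ A := Set.subset_union_left.trans hA2
  have hCD : C ⊆ D := (Set.subset_insert b C).trans hD2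
  have hbD : b ∈ D := hD2 (Set.mem_insert b C)
  obtain ⟨G, hG1, hG2, hG3⟩ := generic_ext L hgen hA1 (starA L R3 C b y)
    (starA_piso L R3 C b y A) (starB_finite L R3 C b y hA1.1 hD1.1)
    (star_A_le L R3 C b y hC1 hCA hCD hA1.1 hD1.1 hb hind)
    (fun X hX => star_Kf L R3 C b y hf hg hlow hC1 hCA hCD hA1.1 hD1.1 hb hind hX)
  refine ⟨G (starC L R3 C b y), fun i => G (starI L R3 C b y i b), fun i => ⟨?_, ?_⟩⟩
  · have hDle := star_D_le L R3 C b y hC1 hCA hCD hA1.1 hD1.1 hb hind i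
    have hcl' : Closed L ((G ∘ starI L R3 C b y i) '' D) := by
      rw [Set.image_comp]
      exact closed_trans L hG2 (hDle.image L hG1)
    have hp : PIso L (G ∘ starI L R3 C b y i) D :=
      (starI_piso L R3 C b y i D).comp L (hG1.mono L hDle.1)
    have hmem : ∀ j, (Fin.snoc a b : Fin (k + 1) → N) j ∈ D := by
      intro j
      refine Fin.lastCases ?_ (fun j => ?_) j
      · rw [Fin.snoc_last]; exact hbD
      · rw [Fin.snoc_castSucc]; exact hCD (hC2 ⟨j, rfl⟩)
    have := sameType_of_piso L hgen hD1 hp hcl' (Fin.snoc a b : Fin (k + 1) → N) hmem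
    convert this using 1
    funext j
    refine Fin.lastCases ?_ (fun j => ?_) j
    · simp
    · have hj : a j ∈ C := hC2 ⟨j, rfl⟩
      simp only [Fin.snoc_castSucc, Function.comp]
      rw [starI_of_mem L R3 C b y hj, hG3 _ (hCA hj)]
  · have h1 := (hG1.2 3 R3 ![starC L R3 C b y, starI L R3 C b y i b, starA L R3 C b y (y i)]
      ?_).2 (starRel L R3 C b y i)
    · convert h1 using 1
      funext j
      have hy := hG3 (y i) (hA2 (Or.inr ⟨i, rfl⟩))
      fin_cases j
      · rfl
      · rfl
      · exact hy.symm
    · intro j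
      fin_cases j
      · exact Or.inl rfl
      · exact Or.inr (Or.inr (Set.mem_iUnion.2 ⟨i, b, hbD, rfl⟩))
      · exact Or.inr (Or.inl ⟨y i, hA2 (Or.inr ⟨i, rfl⟩), rfl⟩)
end Part6

section Part7
section indep
variable {N : Type} [L.Structure N] [Finite (Σ n, L.Relations n)]

/-- `S` is independent over `C` -/
def Indep (C S : Set N) : Prop :=
  ∀ E : Set N, E.Finite → C ⊆ E → delta L C + ((S ∩ E).ncard : ℤ) ≤ delta L E

theorem indep_insert {C S G : Set N} (hS : Indep L C S) (hG : Closed L G)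
    (hCG : C ⊆ G) (hSG : S ⊆ G) {x : N} (hx : x ∉ G) : Indep L C (insert x S) := by
  intro E hE hCE
  by_cases hxE : x ∈ E
  · have h1 := hG.rel_lt L hE fun h => hx (h hxE)
    have h2 := hS (E ∩ G) (hE.inter_of_left G) (Set.subset_inter hCE hCG)
    have h3 : insert x S ∩ E = insert x (S ∩ (E ∩ G)) := by
      rw [Set.insert_inter_of_mem hxE]
      congr 1
      ext z
      exact ⟨fun h => ⟨h.1, h.2, hSG h.1⟩, fun h => ⟨h.1, h.2.1⟩⟩
    have h4 := Set.ncard_insert_le x (S ∩ (E ∩ G))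
    rw [h3]
    omega
  · rw [Set.insert_inter_of_notMem hxE]
    exact hS E hE hCE

theorem exists_indep {f : ℝ → ℝ} (hmono : StrictMonoOn f (Set.Ici 0))
    (hunb : Filter.Tendsto f Filter.atTop Filter.atTop)
    (hlow : ∀ X : Set N, X.Finite → f X.ncard ≤ (delta L X : ℝ)) {C : Set N} (hC : Closed L C)
    (r : ℕ) : ∃ m : ℕ, ∀ Y : Set N, m ≤ Y.ncard →
      ∃ S ⊆ Y, S.Finite ∧ S.ncard = r ∧ Indep L C S := by
  induction r with
  | zero =>
    refine ⟨0, fun Y _ => ⟨∅, Set.empty_subset _, Set.finite_empty, by simp, ?_⟩⟩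
    intro E hE hCE
    simp only [Set.empty_inter, Set.ncard_empty, Nat.cast_zero, add_zero]
    have := hC.rel_le L hE
    rwa [Set.inter_eq_right.2 hCE] at this
  | succ r ih =>
    obtain ⟨m, hm⟩ := ih
    obtain ⟨K, hK⟩ := exists_card_bound L hmono hunb hlow (C.ncard + r)
    refine ⟨max m (K + 1), fun Y hY => ?_⟩
    obtain ⟨S, hSY, hSf, hSr, hSi⟩ := hm Y (le_trans (le_max_left _ _) hY)
    have hfin := hC.1.union hSf
    obtain ⟨hG1, hG2, -⟩ := exists_closure L hmono hunb hlow (C ∪ S) hfin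
    have hK' := hK (C ∪ S) hfin (by
      have := Set.ncard_union_le C S
      omega)
    have hlt : (clM L (C ∪ S)).ncard < Y.ncard := by
      have := le_max_right m (K + 1)
      omega
    obtain ⟨x, hxY, hxG⟩ := Set.exists_mem_notMem_of_ncard_lt_ncard hlt hG1.1
    have hCS := Set.union_subset_iff.1 hG2
    refine ⟨insert x S, Set.insert_subset hxY hSY, hSf.insert x, ?_,
      indep_insert L hSi hG1 hCS.1 hCS.2 hxG⟩
    rw [Set.ncard_insert_of_notMem (fun h => hxG (hCS.2 h)) hSf, hSr]

theorem rel3_bound {f : ℝ → ℝ} (hmono : StrictMonoOn f (Set.Ici 0))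
    (hunb : Filter.Tendsto f Filter.atTop Filter.atTop)
    (hlow : ∀ X : Set N, X.Finite → f X.ncard ≤ (delta L X : ℝ)) (R3 : L.Relations 3) :
    ∃ K : ℕ, ∀ (c z : N) (y : Fin (K + 1) → N),
      (∀ j, Language.Structure.RelMap R3 ![c, z, y j]) → ¬ Function.Injective y := by
  obtain ⟨K, hK⟩ := exists_card_bound L hmono hunb hlow 2
  refine ⟨K, fun c z y hy hinj => ?_⟩
  have hfin : ({c, z} : Set N).Finite := Set.toFinite _
  obtain ⟨hG1, hG2, -⟩ := exists_closure L hmono hunb hlow {c, z} hfin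
  have hK' := hK {c, z} hfin (Set.ncard_insert_le c {z} |>.trans (by simp))
  have hmem : ∀ j, y j ∈ clM L {c, z} := by
    intro j
    by_contra hj
    set G := clM L {c, z}
    have h1 := hG1.2 (insert (y j) G) (Set.ssubset_insert hj) (hG1.1.insert _)
    have h2 := Set.ncard_insert_of_notMem hj hG1.1
    have hc : c ∈ G := hG2 (by simp)
    have hz : z ∈ G := hG2 (by simp)
    have h3 : relsIn L G ⊂ relsIn L (insert (y j) G) := by
      refine ⟨relsIn_mono L (Set.subset_insert _ _), fun h => ?_⟩
      have : (⟨3, R3, ![c, z, y j]⟩ : Σ n, L.Relations n × (Fin n → N)) ∈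
          relsIn L (insert (y j) G) := by
        refine ⟨fun i => ?_, hy j⟩
        change Fin 3 at i
        fin_cases i
        · exact Or.inr hc
        · exact Or.inr hz
        · exact Or.inl rfl
      exact hj ((h this).1 2)
    have h4 := Set.ncard_lt_ncard h3 (relsIn_finite L (hG1.1.insert _))
    rw [delta_eq, delta_eq] at h1
    omega
  have := Set.ncard_le_ncard (Set.range_subset_iff.2 hmem) hG1.1
  rw [← Set.image_univ, Set.ncard_image_of_injective _ hinj, Set.ncard_univ] at this
  simp at this
  omega

theorem dM_mem {X : Set N} {b : N} (hb : b ∈ clM L X) : clM L (X ∪ {b}) = clM L X := by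
  unfold clM
  congr 1
  ext A
  constructor
  · rintro ⟨h1, h2⟩
    exact ⟨Set.subset_union_left.trans h1, h2⟩
  · rintro ⟨h1, h2⟩
    refine ⟨Set.union_subset h1 (Set.singleton_subset_iff.2 ?_), h2⟩
    exact hb A ⟨h1, h2⟩

theorem dM_not_mem {f : ℝ → ℝ} (hmono : StrictMonoOn f (Set.Ici 0))
    (hunb : Filter.Tendsto f Filter.atTop Filter.atTop)
    (hlow : ∀ X : Set N, X.Finite → f X.ncard ≤ (delta L X : ℝ)) {X : Set N} (hX : X.Finite)
    {b : N} (hb : b ∉ clM L X) : dM L (X ∪ {b}) - dM L X = 1 := by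
  obtain ⟨hC1, hC2, -⟩ := exists_closure L hmono hunb hlow X hX
  obtain ⟨hD1, hD2, hD3⟩ := exists_closure L hmono hunb hlow (X ∪ {b})
    (hX.union (Set.finite_singleton b))
  have h1 := hD3 (insert b (clM L X)) (hC1.1.insert b) (by
    rintro x (hx | hx)
    · exact Or.inr (hC2 hx)
    · exact Or.inl hx)
  have h2 := delta_insert_le L hC1.1 b
  have hsub : clM L X ⊆ clM L (X ∪ {b}) := by
    refine Set.sInter_subset_sInter ?_
    rintro A ⟨h1, h2⟩
    exact ⟨Set.subset_union_left.trans h1, h2⟩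
  have h3 := hC1.2 (clM L (X ∪ {b})) ⟨hsub, fun h => hb (h (hD2 (Or.inr rfl)))⟩ hD1.1
  unfold dM
  omega

/-- images of the closure under positive maps stay inside the closure -/
theorem cl_of_hom {f : ℝ → ℝ} (hmono : StrictMonoOn f (Set.Ici 0))
    (hunb : Filter.Tendsto f Filter.atTop Filter.atTop)
    (hlow : ∀ X : Set N, X.Finite → f X.ncard ≤ (delta L X : ℝ)) {X : Set N} (hX : X.Finite)
    (h : N → N) (hi : Set.InjOn h (clM L X)) (hr : ∀ (n : ℕ) (R : L.Relations n) (v : Fin n → N),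
      (∀ i, v i ∈ clM L X) → Language.Structure.RelMap R v → Language.Structure.RelMap R (h ∘ v))
    (hX' : ∀ x ∈ X, h x = x) : ∀ x ∈ clM L X, h x ∈ clM L X := by
  obtain ⟨hC1, hC2, hC3⟩ := exists_closure L hmono hunb hlow X hX
  have h1 := delta_image_le L hC1.1 hi hr
  have hfin := hC1.1.image h
  have hXW : X ⊆ h '' clM L X := fun x hx => ⟨x, hC2 hx, hX' x hx⟩
  intro x hx
  by_contra hxn
  have h2 := hC1.rel_lt L hfin fun h' => hxn (h' ⟨x, hx, rfl⟩)
  have h3 := hC3 (h '' clM L X ∩ clM L X) (hfin.inter_of_left _) (Set.subset_inter hXW hC2)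
  omega
end indep

theorem psi_claim {N : Type} [Nonempty N] [L.IsRelational] [L.Structure N]
    [Finite (Σ n, L.Relations n)] (R3 : L.Relations 3) {f g : ℝ → ℝ} (hf : IsGoodFun f g)
    (hg : ∀ x ∈ Set.Ici (0 : ℝ), g x ≤ 1 / (2 * (x + 1))) (hgen : IsGeneric L (N := N) f)
    {k : ℕ} (a : Fin k → N) (b : N) (hb : b ∉ clM L (Set.range a)) (r : ℕ) :
    ∃ m : ℕ, ∀ y : Fin m → N, Function.Injective y → ∃ c : N, ∃ I : Finset (Fin m), I.card = r ∧
      ∀ i ∈ I, ∃ z : N, sameType L (Fin.snoc a z : Fin (k + 1) → N) (Fin.snoc a b) ∧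
        Language.Structure.RelMap R3 ![c, z, y i] := by
  classical
  have hlow := generic_low' L hgen
  obtain ⟨hC1, hC2, -⟩ := exists_closure L hf.mono hf.unbounded hlow (Set.range a)
    (Set.finite_range a)
  obtain ⟨m, hm⟩ := exists_indep L hf.mono hf.unbounded hlow hC1 r
  refine ⟨m, fun y hy => ?_⟩
  obtain ⟨S, hSY, hSf, hSr, hSi⟩ := hm (Set.range y) (by
    rw [← Set.image_univ, Set.ncard_image_of_injective _ hy, Set.ncard_univ]; simp)
  set I : Finset (Fin m) := Finset.univ.filter fun i => y i ∈ S with hI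
  have hIS : y '' (I : Set (Fin m)) = S := by
    apply Set.Subset.antisymm
    · rintro _ ⟨i, hi, rfl⟩
      exact (Finset.mem_filter.1 hi).2
    · intro x hx
      obtain ⟨i, rfl⟩ := hSY hx
      exact ⟨i, by simp [hI, hx], rfl⟩
  have hIr : I.card = r := by
    rw [← hSr, ← hIS, Set.ncard_image_of_injective _ hy, Set.ncard_coe_finset]
  obtain ⟨c, z, hz⟩ := star_claim L R3 hf hg hgen a b hb (fun i : I => y i) (by
    intro E hE hCE
    have h1 := hSi E hE hCE
    have h2 : {i : I | y i ∈ E}.ncard ≤ (S ∩ E).ncard := by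
      refine Set.ncard_le_ncard_of_injOn (fun i : I => y i) ?_ ?_ (hSf.inter_of_left E)
      · intro i hi
        exact ⟨(Finset.mem_filter.1 i.2).2, hi⟩
      · intro i _ j _ hij
        exact Subtype.ext (hy hij)
    omega)
  exact ⟨c, I, hIr, fun i hi => ⟨z ⟨i, hi⟩, hz ⟨i, hi⟩⟩⟩
end Part7

section Part8
/-- uniformly definable properties -/
def UD (α : Type) (P : ∀ (M : Type) [L.Structure M], (α → M) → Prop) : Prop :=
  ∃ φ : L.Formula α, ∀ (M : Type) [L.Structure M] (v : α → M), φ.Realize v ↔ P M v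

section UD
variable {α β : Type}

theorem UD.form {γ : Type} (φ : L.Formula γ) (g : γ → α) :
    UD L α fun _ _ v => φ.Realize fun j => v (g j) :=
  ⟨φ.relabel g, fun _ _ _ => Language.Formula.realize_relabel⟩

theorem UD.const (p : Prop) : UD L α fun _ _ _ => p := by
  by_cases hp : p
  · exact ⟨⊤, fun _ _ _ => by simp [hp]⟩
  · exact ⟨⊥, fun _ _ _ => by simp [hp]⟩

theorem UD.eq (i j : α) : UD L α fun _ _ v => v i = v j :=
  ⟨(Language.Term.var i).equal (Language.Term.var j), fun _ _ _ => by
    rw [Language.Formula.realize_equal]; rfl⟩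

theorem UD.rel {n : ℕ} (R : L.Relations n) (xs : Fin n → α) :
    UD L α fun _ _ v => Language.Structure.RelMap R fun i => v (xs i) :=
  ⟨R.formula fun i => Language.Term.var (xs i), fun _ _ _ => by
    rw [Language.Formula.realize_rel]; rfl⟩

theorem UD.rel3 (R : L.Relations 3) (p q r : α) :
    UD L α fun _ _ v => Language.Structure.RelMap R ![v p, v q, v r] := by
  obtain ⟨φ, hφ⟩ := UD.rel L R ![p, q, r]
  refine ⟨φ, fun M _ v => (hφ M v).trans ?_⟩
  have : (fun i => v (![p, q, r] i)) = ![v p, v q, v r] := by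
    funext i; fin_cases i <;> rfl
  beta_reduce
  rw [this]

theorem UD.formab {k : ℕ} (φ : L.Formula (Fin k ⊕ Fin 1)) (g : Fin k → α) (z : α) :
    UD L α fun _ _ v => φ.Realize (Sum.elim (fun j => v (g j)) fun _ => v z) := by
  obtain ⟨ψ, hψ⟩ := UD.form L φ (Sum.elim g fun _ => z)
  refine ⟨ψ, fun M _ v => (hψ M v).trans ?_⟩
  have : (fun j => v (Sum.elim g (fun _ : Fin 1 => z) j)) =
      Sum.elim (fun j => v (g j)) fun _ => v z := by
    funext i; cases i <;> rfl
  beta_reduce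
  rw [this]

variable {P Q : ∀ (M : Type) [L.Structure M], (α → M) → Prop}

theorem UD.and (hP : UD L α P) (hQ : UD L α Q) : UD L α fun M _ v => P M v ∧ Q M v := by
  obtain ⟨φ, hφ⟩ := hP
  obtain ⟨ψ, hψ⟩ := hQ
  exact ⟨φ ⊓ ψ, fun M _ v => by rw [Language.Formula.realize_inf, hφ, hψ]⟩

theorem UD.imp (hP : UD L α P) (hQ : UD L α Q) : UD L α fun M _ v => P M v → Q M v := by
  obtain ⟨φ, hφ⟩ := hP
  obtain ⟨ψ, hψ⟩ := hQ
  exact ⟨φ.imp ψ, fun M _ v => by rw [Language.Formula.realize_imp, hφ, hψ]⟩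

theorem UD.not (hP : UD L α P) : UD L α fun M _ v => ¬ P M v := by
  obtain ⟨φ, hφ⟩ := hP
  exact ⟨φ.not, fun M _ v => by rw [Language.Formula.realize_not, hφ]⟩

theorem UD.conj {ι : Type*} [Finite ι] {P : ι → ∀ (M : Type) [L.Structure M], (α → M) → Prop}
    (h : ∀ i, UD L α (P i)) : UD L α fun M _ v => ∀ i, P i M v := by
  choose φ hφ using h
  exact ⟨Language.Formula.iInf φ, fun M _ v => by
    rw [Language.Formula.realize_iInf]; exact forall_congr' fun i => hφ i M v⟩

theorem UD.disj {ι : Type*} [Finite ι] {P : ι → ∀ (M : Type) [L.Structure M], (α → M) → Prop}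
    (h : ∀ i, UD L α (P i)) : UD L α fun M _ v => ∃ i, P i M v := by
  choose φ hφ using h
  exact ⟨Language.Formula.iSup φ, fun M _ v => by
    rw [Language.Formula.realize_iSup]; exact exists_congr fun i => hφ i M v⟩

theorem UD.all [Finite β] {Q : ∀ (M : Type) [L.Structure M], (α → M) → (β → M) → Prop}
    (h : UD L (α ⊕ β) fun M _ v => Q M (fun i => v (Sum.inl i)) (fun i => v (Sum.inr i))) :
    UD L α fun M _ v => ∀ w : β → M, Q M v w := by
  obtain ⟨φ, hφ⟩ := h
  refine ⟨φ.iAlls, fun M _ v => ?_⟩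
  rw [Language.Formula.realize_iAlls]
  exact forall_congr' fun w => hφ M (Sum.elim v w)

theorem UD.ex [Finite β] {Q : ∀ (M : Type) [L.Structure M], (α → M) → (β → M) → Prop}
    (h : UD L (α ⊕ β) fun M _ v => Q M (fun i => v (Sum.inl i)) (fun i => v (Sum.inr i))) :
    UD L α fun M _ v => ∃ w : β → M, Q M v w := by
  obtain ⟨φ, hφ⟩ := h
  refine ⟨φ.iExs, fun M _ v => ?_⟩
  rw [Language.Formula.realize_iExs]
  exact exists_congr fun w => hφ M (Sum.elim v w)

theorem UD.all1 {Q : ∀ (M : Type) [L.Structure M], (α → M) → M → Prop}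
    (h : UD L (α ⊕ Unit) fun M _ v => Q M (fun i => v (Sum.inl i)) (v (Sum.inr ()))) :
    UD L α fun M _ v => ∀ w : M, Q M v w := by
  obtain ⟨φ, hφ⟩ := UD.all L (β := Unit) (Q := fun M _ v w => Q M v (w ())) h
  exact ⟨φ, fun M _ v => (hφ M v).trans ⟨fun h w => h fun _ => w, fun h w => h _⟩⟩

theorem UD.ex1 {Q : ∀ (M : Type) [L.Structure M], (α → M) → M → Prop}
    (h : UD L (α ⊕ Unit) fun M _ v => Q M (fun i => v (Sum.inl i)) (v (Sum.inr ()))) :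
    UD L α fun M _ v => ∃ w : M, Q M v w := by
  obtain ⟨φ, hφ⟩ := UD.ex L (β := Unit) (Q := fun M _ v w => Q M v (w ())) h
  exact ⟨φ, fun M _ v => (hφ M v).trans ⟨fun ⟨w, h⟩ => ⟨_, h⟩, fun ⟨w, h⟩ => ⟨fun _ => w, h⟩⟩⟩

theorem UD.inj [Finite β] (g : β → α) :
    UD L α fun _ _ v => Function.Injective fun j => v (g j) := by
  have : UD L α fun _ _ v => ∀ i j : β, v (g i) = v (g j) → i = j :=
    UD.conj L fun i => UD.conj L fun j => UD.imp L (UD.eq L _ _) (UD.const L _)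
  obtain ⟨φ, hφ⟩ := this
  exact ⟨φ, fun M _ v => (hφ M v).trans Iff.rfl⟩

end UD

section props
variable {k : ℕ} (Φ : L.Formula (Fin k ⊕ Fin 1)) (R3 : L.Relations 3)

theorem UD_psi (m r : ℕ) : UD L (Fin k) fun M _ x => ∀ y : Fin m → M, Function.Injective y →
    ∃ c : M, ∃ I : Finset (Fin m), I.card = r ∧ ∀ i : Fin m, i ∈ I → ∃ z : M,
      Φ.Realize (Sum.elim x fun _ => z) ∧ Language.Structure.RelMap R3 ![c, z, y i] := by
  refine UD.all L (UD.imp L (UD.inj L Sum.inr) (UD.ex1 L (UD.disj L fun I => UD.and L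
    (UD.const L _) (UD.conj L fun i => UD.imp L (UD.const L _) (UD.ex1 L (UD.and L ?_ ?_))))))
  · exact UD.formab L Φ _ _
  · exact UD.rel3 L R3 _ _ _

theorem UD_K (K : ℕ) : UD L (Fin k) fun M _ _ => ∀ c z : M, ∀ y : Fin K → M,
    (∀ j, Language.Structure.RelMap R3 ![c, z, y j]) → ¬ Function.Injective y := by
  refine UD.all1 L (UD.all1 L (UD.all L (UD.imp L (UD.conj L fun j => ?_)
    (UD.not L (UD.inj L Sum.inr)))))
  exact UD.rel3 L R3 _ _ _

theorem UD_ex : UD L (Fin k) fun M _ x => ∃ z : M, Φ.Realize (Sum.elim x fun _ => z) :=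
  UD.ex1 L (UD.formab L Φ _ _)

theorem UD_fin (K : ℕ) : UD L (Fin k) fun M _ x => ∀ z : Fin K → M,
    (∀ j, Φ.Realize (Sum.elim x fun _ => z j)) → ¬ Function.Injective z := by
  refine UD.all L (UD.imp L (UD.conj L fun j => ?_) (UD.not L (UD.inj L Sum.inr)))
  exact UD.formab L Φ _ _

end props

/-- the algebraic case -/
theorem alg_fin {N : Type} [L.Structure N] [Finite (Σ n, L.Relations n)]
    {f : ℝ → ℝ} (hmono : StrictMonoOn f (Set.Ici 0))
    (hunb : Filter.Tendsto f Filter.atTop Filter.atTop)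
    (hlow : ∀ X : Set N, X.Finite → f X.ncard ≤ (delta L X : ℝ))
    {k : ℕ} (a : Fin k → N) (b : N) (hb : b ∈ clM L (Set.range a)) (z : N)
    (hz : sameType L (Fin.snoc a z : Fin (k + 1) → N) (Fin.snoc a b)) :
    z ∈ clM L (Set.range a) := by
  classical
  obtain ⟨hC1, hC2, -⟩ := exists_closure L hmono hunb hlow (Set.range a) (Set.finite_range a)
  set C := clM L (Set.range a) with hC
  have : Finite C := hC1.1
  have : Finite (relsIn L C) := relsIn_finite L hC1.1
  have hud : UD L (Fin (k + 1)) fun M _ v => ∃ w : C → M,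
      (∀ j : Fin k, w ⟨a j, hC2 ⟨j, rfl⟩⟩ = v j.castSucc) ∧ w ⟨b, hb⟩ = v (Fin.last k) ∧
      Function.Injective w ∧ ∀ p : relsIn L C,
        Language.Structure.RelMap p.1.2.1 fun i => w ⟨p.1.2.2 i, p.2.1 i⟩ := by
    refine UD.ex L (UD.and L (UD.conj L fun j => ?_) (UD.and L ?_ (UD.and L
      (UD.inj L Sum.inr) (UD.conj L fun p => ?_))))
    · exact UD.eq L _ _
    · exact UD.eq L _ _
    · exact UD.rel L p.1.2.1 fun i => (Sum.inr ⟨p.1.2.2 i, p.2.1 i⟩ : Fin (k + 1) ⊕ C)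
  obtain ⟨φ, hφ⟩ := hud
  have h1 := (hz φ).2 ((hφ N _).2 ⟨Subtype.val, by simp, by simp, Subtype.val_injective,
    fun p => p.2.2⟩)
  obtain ⟨w, hw1, hw2, hw3, hw4⟩ := (hφ N _).1 h1
  let h : N → N := fun x => if hx : x ∈ C then w ⟨x, hx⟩ else x
  have hh : ∀ x (hx : x ∈ C), h x = w ⟨x, hx⟩ := fun x hx => dif_pos hx
  have := cl_of_hom L hmono hunb hlow (Set.finite_range a) h ?_ ?_ ?_ b hb
  · rw [hh b hb, hw2] at this
    simpa using this
  · intro x hx x' hx' hxx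
    rw [hh x hx, hh x' hx'] at hxx
    exact congrArg Subtype.val (hw3 hxx)
  · intro n R v hv hR
    have := hw4 ⟨⟨n, R, v⟩, hv, hR⟩
    convert this using 1
    funext i
    exact hh _ _
  · rintro _ ⟨j, rfl⟩
    rw [hh _ (hC2 ⟨j, rfl⟩), hw1]
    simp

theorem transfer {N : Type} [Nonempty N] [L.Structure N]
    (U : Ultrafilter ℕ) (F : ℕ → Type) [∀ i, L.Structure (F i)]
    (helem : N ≅[L] ((U : Filter ℕ).Product F))
    {k : ℕ} (a : Fin k → N) (Φa : L.Formula (Fin k))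
    (hΦa : ∀ x : Fin k → N, Φa.Realize x ↔ sameType L x a)
    (p : ∀ i : ℕ, Fin k → F i)
    (hp : Φa.Realize (fun j => (↑(fun i => p i j) : ((U : Filter ℕ)).Product F)))
    {P : ∀ (M : Type) [L.Structure M], (Fin k → M) → Prop} (hP : UD L (Fin k) P) (hPa : P N a) :
    ∀ᶠ i in (U : Filter ℕ), P (F i) (p i) := by
  have hne : ∀ i, Nonempty (F i) := by
    obtain ⟨q⟩ := helem.nonempty
    obtain ⟨q, -⟩ := Quotient.exists_rep q
    exact fun i => ⟨q i⟩
  obtain ⟨φ, hφ⟩ := hP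
  have h1 : UD L Empty fun M _ _ => ∀ x : Fin k → M, Φa.Realize x → φ.Realize x := by
    refine UD.all L (UD.imp L ?_ ?_)
    · exact UD.form L Φa _
    · exact UD.form L φ _
  obtain ⟨ψ, hψ⟩ := h1
  have h2 : N ⊨ ψ := (hψ N _).2 fun x hx => ((hΦa x).1 hx φ).2 ((hφ N a).2 hPa)
  have h3 := (helem.realize_sentence ψ).1 h2
  have h4 := (hψ _ _).1 h3 _ hp
  have h5 := (Language.Ultraproduct.realize_formula_cast φ fun j i => p i j).1 h4
  exact h5.mono fun i hi => (hφ _ _).1 hi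
end Part8

section Part9
theorem card_le_of_no_inj {M : Type} (K : ℕ) (s : Finset M)
    (h : ∀ y : Fin (K + 1) → M, (∀ j, y j ∈ s) → ¬ Function.Injective y) : s.card ≤ K := by
  by_contra! hlt
  obtain ⟨e⟩ := Function.Embedding.nonempty_of_card_le
    (α := Fin (K + 1)) (β := s) (by simpa using hlt)
  exact h (fun j => e j) (fun j => (e j).2) fun i j hij => e.injective (Subtype.ext hij)

theorem count_nat {M : Type} [Fintype M] (Z : Finset M) (Rel : M → M → M → Prop) (m r K : ℕ)
    (hψ : ∀ y : Fin m → M, Function.Injective y → ∃ c : M, ∃ I : Finset (Fin m), I.card = r ∧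
      ∀ i : Fin m, i ∈ I → ∃ z : M, z ∈ Z ∧ Rel c z (y i))
    (hK : ∀ c z : M, ∀ y : Fin (K + 1) → M, (∀ j, Rel c z (y j)) → ¬ Function.Injective y) :
    (Fintype.card M).descFactorial m ≤
      Fintype.card M * 2 ^ m * ((K * Z.card) ^ r * Fintype.card M ^ (m - r)) := by
  classical
  set n := Fintype.card M with hn
  let S : M → Finset M := fun c => Z.biUnion fun z => Finset.univ.filter fun x => Rel c z x
  have hS : ∀ c, (S c).card ≤ K * Z.card := by
    intro c
    rw [mul_comm]
    refine Finset.card_biUnion_le_card_mul _ _ _ fun z _ => ?_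
    refine card_le_of_no_inj K _ fun y hy => hK c z y fun j => ?_
    exact (Finset.mem_filter.1 (hy j)).2
  let T : M → Finset (Fin m) → Finset (Fin m → M) := fun c I =>
    Fintype.piFinset fun j => if j ∈ I then S c else Finset.univ
  have hT : ∀ c, ∀ I ∈ Finset.powersetCard r (Finset.univ : Finset (Fin m)),
      (T c I).card ≤ (K * Z.card) ^ r * n ^ (m - r) := by
    intro c I hI
    have hI' := (Finset.mem_powersetCard.1 hI).2
    have h1 : (T c I).card = (S c).card ^ r * n ^ (m - r) := by
      simp only [T, Fintype.card_piFinset, apply_ite Finset.card, Finset.prod_ite,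
        Finset.prod_const, Finset.card_univ]
      have h2 : (Finset.univ.filter fun x => x ∈ I) = I := by ext; simp
      have h3 : (Finset.univ.filter fun x => x ∉ I) = Iᶜ := by ext; simp
      rw [h2, h3, hI', Finset.card_compl, hI', Fintype.card_fin]
    rw [h1]
    gcongr
    exact hS c
  let W : Finset (Fin m → M) := Finset.univ.biUnion fun c =>
    (Finset.powersetCard r (Finset.univ : Finset (Fin m))).biUnion fun I => T c I
  have hW : W.card ≤ n * (2 ^ m * ((K * Z.card) ^ r * n ^ (m - r))) := by
    refine Finset.card_biUnion_le_card_mul _ _ _ fun c _ => ?_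
    refine (Finset.card_biUnion_le_card_mul _ _ _ (hT c)).trans ?_
    gcongr
    rw [Finset.card_powersetCard]
    simpa using Nat.choose_le_two_pow m r
  rw [mul_assoc]
  refine le_trans ?_ hW
  have he : (Fintype.card M).descFactorial m = Fintype.card (Fin m ↪ M) := by
    rw [Fintype.card_embedding_eq, Fintype.card_fin]
  rw [hn, he, ← Finset.card_univ]
  refine Finset.card_le_card_of_injOn (fun e : Fin m ↪ M => (e : Fin m → M)) ?_
    (fun e _ e' _ h => DFunLike.coe_injective h)
  intro e _
  obtain ⟨c, I, hI, h⟩ := hψ e e.injective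
  refine Finset.mem_biUnion.2 ⟨c, Finset.mem_univ _, Finset.mem_biUnion.2
    ⟨I, Finset.mem_powersetCard.2 ⟨Finset.subset_univ _, hI⟩, Fintype.mem_piFinset.2 fun j => ?_⟩⟩
  by_cases hj : j ∈ I
  · rw [if_pos hj]
    obtain ⟨z, hz, hR⟩ := h j hj
    exact Finset.mem_biUnion.2 ⟨z, hz, Finset.mem_filter.2 ⟨Finset.mem_univ _, hR⟩⟩
  · rw [if_neg hj]; exact Finset.mem_univ _

theorem count_log (n m r K D : ℕ) (hr : 1 ≤ r) (hrm : r ≤ m) (hn : 2 * m ≤ n) (hn1 : 1 ≤ n)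
    (h : n.descFactorial m ≤ n * 2 ^ m * ((K * D) ^ r * n ^ (m - r))) :
    ((r : ℝ) - 1) * Real.log n - (m * Real.log 4 + r * Real.log K) ≤ r * Real.log D := by
  have h1 : n ^ m ≤ 2 ^ m * n.descFactorial m := by
    refine le_trans ?_ (Nat.mul_le_mul_left _ (Nat.pow_sub_le_descFactorial n m))
    rw [← mul_pow]
    exact Nat.pow_le_pow_left (by omega) m
  have h2 : n ^ (m - r) * n ^ r ≤ n ^ (m - r) * (n * 4 ^ m * (K * D) ^ r) := by
    calc n ^ (m - r) * n ^ r = n ^ m := by rw [← pow_add]; congr 1; omega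
      _ ≤ 2 ^ m * (n * 2 ^ m * ((K * D) ^ r * n ^ (m - r))) :=
        h1.trans (Nat.mul_le_mul_left _ h)
      _ = n ^ (m - r) * (n * (2 * 2) ^ m * (K * D) ^ r) := by rw [mul_pow 2 2]; ring
  have h3 : n ^ r ≤ n * 4 ^ m * (K * D) ^ r := Nat.le_of_mul_le_mul_left h2 (by positivity)
  have hKD : 0 < K * D := by
    rcases Nat.eq_zero_or_pos (K * D) with h0 | h0
    · rw [h0, zero_pow (by omega), mul_zero] at h3
      have : 0 < n ^ r := by positivity
      omega
    · exact h0
  have hK : 0 < K := Nat.pos_of_mul_pos_right hKD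
  have hD : 0 < D := Nat.pos_of_mul_pos_left hKD
  have h4 : (n : ℝ) ^ r ≤ n * 4 ^ m * (K * D) ^ r := by exact_mod_cast h3
  have hn' : (0 : ℝ) < n := by exact_mod_cast hn1
  have hK' : (0 : ℝ) < K := by exact_mod_cast hK
  have hD' : (0 : ℝ) < D := by exact_mod_cast hD
  have h5 := Real.log_le_log (by positivity) h4
  rw [Real.log_mul (by positivity) (by positivity), Real.log_mul (by positivity) (by positivity),
    Real.log_pow, Real.log_pow, Real.log_pow, Real.log_mul hK'.ne' hD'.ne'] at h5
  linarith
end Part9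

/-- **Claim in Remark 4.6**: suppose the generic structure `M_f` is elementarily
equivalent to an ultraproduct `𝓜 = ∏_U F_i` of finite structures with `|F_i| → ∞`.
If `ā` is a `k`-tuple and `b` an element of `M_f`, with isolating formulas `Φ_ā` and
`Φ_{āb}`, then for every `ū ∈ 𝓜^k` with `𝓜 ⊨ Φ_ā(ū)`, the coarse pseudofinite dimension
satisfies `Δ(Φ_{āb}(ū, y)) = d(b/ā)`. -/
theorem coarse_pseudofinite_dim_over_tuple
    (L : FirstOrder.Language) [L.IsRelational]
    [Finite (Σ n, L.Relations n)] (R3 : L.Relations 3)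
    (f g : ℝ → ℝ) (hf : IsGoodFun f g)
    (hg : ∀ x ∈ Set.Ici (0 : ℝ), g x ≤ 1 / (2 * (x + 1)))
    (N : Type) [L.Structure N] [Countable N]
    (hgen : IsGeneric L (N := N) f)
    (U : Ultrafilter ℕ) (hU : (U : Filter ℕ) ≤ Filter.cofinite) (F : ℕ → Type)
    [∀ i, L.Structure (F i)] [∀ i, Fintype (F i)]
    (hcard : Filter.Tendsto (fun i => Fintype.card (F i)) Filter.atTop Filter.atTop)
    (helem : N ≅[L] ((U : Filter ℕ).Product F))
    (k : ℕ) (a : Fin k → N) (b : N)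
    (Φa : L.Formula (Fin k))
    (hΦa : ∀ x : Fin k → N, Φa.Realize x ↔ sameType L x a)
    (Φab : L.Formula (Fin k ⊕ Fin 1))
    (hΦab : ∀ (x : Fin k → N) (y : N),
      Φab.Realize (Sum.elim x fun _ => y) ↔
        sameType L (Fin.snoc x y) (Fin.snoc a b))
    (p : ∀ i : ℕ, Fin k → F i)
    (hp : Φa.Realize
      (fun j => (↑(fun i => p i j) : ((U : Filter ℕ)).Product F))) :
    Filter.Tendsto
      (fun i : ℕ =>
        Real.log ({y : F i | Φab.Realize (Sum.elim (p i) fun _ => y)}.ncard) /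
          Real.log (Fintype.card (F i)))
      (U : Filter ℕ)
      (nhds ((dM L (Set.range a ∪ {b}) - dM L (Set.range a) : ℤ) : ℝ)) := by
  classical
  have hN : Nonempty N := ⟨b⟩
  have hlow := generic_low' L hgen
  have hcardU : Filter.Tendsto (fun i => Fintype.card (F i)) (U : Filter ℕ) Filter.atTop :=
    hcard.mono_left (hU.trans Nat.cofinite_eq_atTop.le)
  have hlogU : Filter.Tendsto (fun i => Real.log (Fintype.card (F i))) (U : Filter ℕ)
      Filter.atTop :=
    Real.tendsto_log_atTop.comp (tendsto_natCast_atTop_atTop.comp hcardU)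
  have hab : ∀ z : N, Φab.Realize (Sum.elim a fun _ => z) ↔
      sameType L (Fin.snoc a z : Fin (k + 1) → N) (Fin.snoc a b) := hΦab a
  have hset : ∀ i, {y : F i | Φab.Realize (Sum.elim (p i) fun _ => y)}.ncard =
      (Finset.univ.filter fun y : F i => Φab.Realize (Sum.elim (p i) fun _ => y)).card := by
    intro i
    rw [← Set.ncard_coe_finset]
    congr 1
    ext y
    simp
  simp only [hset]
  have htr := fun {P : ∀ (M : Type) [L.Structure M], (Fin k → M) → Prop} =>
    transfer L U F helem a Φa hΦa p hp (P := P)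
  by_cases hb : b ∈ clM L (Set.range a)
  · have hd : dM L (Set.range a ∪ {b}) - dM L (Set.range a) = 0 := by
      unfold dM
      rw [dM_mem L hb, sub_self]
    rw [hd, Int.cast_zero]
    obtain ⟨hC1, hC2, -⟩ := exists_closure L hf.mono hf.unbounded hlow (Set.range a)
      (Set.finite_range a)
    set K := (clM L (Set.range a)).ncard with hK
    have h1 := htr (UD_fin L Φab (K + 1)) (by
      intro z hz hinj
      have hmem : ∀ j, z j ∈ clM L (Set.range a) := fun j =>
        alg_fin L hf.mono hf.unbounded hlow a b hb (z j) ((hab _).1 (hz j))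
      have := Set.ncard_le_ncard (Set.range_subset_iff.2 hmem) hC1.1
      rw [← Set.image_univ, Set.ncard_image_of_injective _ hinj, Set.ncard_univ] at this
      simp at this
      omega)
    have h2 : Filter.Tendsto (fun i => Real.log K / Real.log (Fintype.card (F i)))
        (U : Filter ℕ) (nhds 0) := Filter.Tendsto.const_div_atTop hlogU _
    refine tendsto_of_tendsto_of_tendsto_of_le_of_le' tendsto_const_nhds h2 ?_ ?_
    · filter_upwards with i
      exact div_nonneg (Real.log_natCast_nonneg _) (Real.log_natCast_nonneg _)
    · filter_upwards [h1] with i hi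
      have h3 : (Finset.univ.filter fun y : F i =>
          Φab.Realize (Sum.elim (p i) fun _ => y)).card ≤ K :=
        card_le_of_no_inj K _ fun y hy => hi y fun j => (Finset.mem_filter.1 (hy j)).2
      refine div_le_div_of_nonneg_right ?_ (Real.log_natCast_nonneg _)
      rcases Nat.eq_zero_or_pos (Finset.univ.filter fun y : F i =>
          Φab.Realize (Sum.elim (p i) fun _ => y)).card with h0 | h0
      · rw [h0]
        simpa using Real.log_natCast_nonneg K
      · exact Real.log_le_log (by exact_mod_cast h0) (by exact_mod_cast h3)
  · rw [dM_not_mem L hf.mono hf.unbounded hlow (Set.finite_range a) hb, Int.cast_one]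
    obtain ⟨K, hK⟩ := rel3_bound L hf.mono hf.unbounded hlow R3
    have hKi := htr (UD_K L R3 (K + 1)) hK
    refine tendsto_order.2 ⟨fun l hl => ?_, fun u hu => ?_⟩
    · obtain ⟨r, hr⟩ := exists_nat_gt (2 / (1 - l))
      have hl' : 0 < 1 - l := by linarith
      have hr0 : (0 : ℝ) < r := lt_trans (by positivity) hr
      have hr1 : 1 ≤ r := by exact_mod_cast hr0
      obtain ⟨m, hm⟩ := psi_claim L R3 hf hg hgen a b hb r
      have hmi := htr (UD_psi L Φab R3 m r) (by
        intro y hy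
        obtain ⟨c, I, hI, h⟩ := hm y hy
        refine ⟨c, I, hI, fun i hi => ?_⟩
        obtain ⟨z, hz1, hz2⟩ := h i hi
        exact ⟨z, (hab z).2 hz1, hz2⟩)
      filter_upwards [hKi, hmi, hcardU.eventually_ge_atTop (2 * m),
        hcardU.eventually_ge_atTop 1, hlogU.eventually_gt_atTop 0,
        hlogU.eventually_gt_atTop (m * Real.log 4 + r * Real.log K)] with i h1 h2 h3 h4 h5 h6
      have hrm : r ≤ m := by
        obtain ⟨e⟩ := Function.Embedding.nonempty_of_card_le
          (α := Fin m) (β := F i) (by rw [Fintype.card_fin]; omega)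
        obtain ⟨c, I, hI, -⟩ := h2 e e.injective
        rw [← hI]
        simpa using Finset.card_le_univ I
      have h7 := count_nat (Finset.univ.filter fun y : F i =>
          Φab.Realize (Sum.elim (p i) fun _ => y))
        (fun c z y => Language.Structure.RelMap R3 ![c, z, y]) m r K (by
          intro y hy
          obtain ⟨c, I, hI, h⟩ := h2 y hy
          refine ⟨c, I, hI, fun j hj => ?_⟩
          obtain ⟨z, hz1, hz2⟩ := h j hj
          exact ⟨z, Finset.mem_filter.2 ⟨Finset.mem_univ _, hz1⟩, hz2⟩) h1
      have h8 := count_log _ m r K _ hr1 hrm h3 h4 h7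
      rw [lt_div_iff₀ h5]
      rw [div_lt_iff₀ hl'] at hr
      set x := Real.log (Fintype.card (F i))
      have h9 : (2 : ℝ) * x < r * (1 - l) * x := mul_lt_mul_of_pos_right hr h5
      have h10 : (r : ℝ) * (l * x) < r * Real.log ((Finset.univ.filter fun y : F i =>
          Φab.Realize (Sum.elim (p i) fun _ => y)).card : ℝ) := by
        linarith
      exact lt_of_mul_lt_mul_left h10 hr0.le
    · filter_upwards [hlogU.eventually_gt_atTop 0, htr (UD_ex L Φab) ⟨b, (hab b).2 fun _ => Iff.rfl⟩]
        with i h5 h6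
      refine lt_of_le_of_lt ?_ hu
      rw [div_le_one h5]
      obtain ⟨z, hz⟩ := h6
      refine Real.log_le_log ?_ ?_
      · exact_mod_cast Finset.card_pos.2 ⟨z, Finset.mem_filter.2 ⟨Finset.mem_univ _, hz⟩⟩
      · exact_mod_cast Finset.card_le_univ _

end MeasureAmalgamation
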